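/- arXiv:1804.05096 — 10 statements merged into one kernel-verified Lean document; each statement's English description precedes it below -/
import Mathlib

section
/- Suppose $u$ satisfies $u(ab)u(c)=u(a)u(bc)$ mod $t^{n+1}$ for some $n\ge1$. Then there exists a $k$-linear map $u_{n+1}:A\to A$ such that the resulting $u$ satisfies $u(ab)u(c)=u(a)u(bc)$ mod $t^{n+2}$ if and only if there exists a $k$-linear map $v:A\to A$ with $\delta_2(v)(a,b,c)=\sum_{i=1}^{n}(u_i\circ u_{n+1-i})(a,b,c)$ for all $a,b,c\in A$ (i.e. the obstruction $\sum_{i=1}^{n}u_i\circ u_{n+1-i}$ vanishes in $H^3_{S^2}(A,A)$). -/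
/-- `u` satisfies the identity `u(ab)u(c) = u(a)u(bc)` mod `t^N`: for all `a,b,c ∈ A` and all
`0 ≤ j < N`, the coefficient of `t^j` on both sides agrees. -/
def SatisfiesDeformEq {k A : Type*} [Field k] [CommRing A] [Algebra k A]
    (u : ℕ → (A →ₗ[k] A)) (N : ℕ) : Prop :=
  ∀ a b c : A, ∀ j < N,
    ∑ i ∈ Finset.range (j + 1), u i (a * b) * u (j - i) c =
      ∑ i ∈ Finset.range (j + 1), u i a * u (j - i) (b * c)

theorem hh_split_sum {A : Type*} [CommRing A] (n : ℕ) (f g : ℕ → A) :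
    ∑ i ∈ Finset.range (n + 1 + 1), f i * g (n + 1 - i) =
      f 0 * g (n + 1) + f (n + 1) * g 0 + ∑ i ∈ Finset.Icc 1 n, f i * g (n + 1 - i) := by
  rw [Finset.sum_range_succ, Finset.sum_range_succ']
  have e : Finset.Icc 1 n = Finset.Ico 1 (n + 1) := by ext; simp
  rw [e, Finset.sum_Ico_eq_sum_range]
  simp only [Nat.sub_self, Nat.sub_zero, Nat.add_sub_cancel, Nat.add_comm 1]
  ring

theorem hh_reflect {A : Type*} [CommRing A] (n : ℕ) (f g : ℕ → A) :
    ∑ i ∈ Finset.Icc 1 n, f i * g (n + 1 - i) = ∑ i ∈ Finset.Icc 1 n, g i * f (n + 1 - i) := by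
  refine Finset.sum_bij' (fun i _ => n + 1 - i) (fun i _ => n + 1 - i) ?_ ?_ ?_ ?_ ?_
  · intro i hi; simp only [Finset.mem_Icc] at *; omega
  · intro i hi; simp only [Finset.mem_Icc] at *; omega
  · intro i hi; simp only [Finset.mem_Icc] at *; omega
  · intro i hi; simp only [Finset.mem_Icc] at *; omega
  · intro i hi
    simp only [Finset.mem_Icc] at hi
    have : n + 1 - (n + 1 - i) = i := by omega
    rw [this, mul_comm]

theorem hh_key {k A : Type*} [Field k] [CommRing A] [Algebra k A]
    (u : ℕ → (A →ₗ[k] A)) (hu0 : u 0 = LinearMap.id) (n : ℕ) (v : A →ₗ[k] A) (x y : A) :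
    ∑ i ∈ Finset.range (n + 1 + 1), Function.update u (n + 1) v i x *
        Function.update u (n + 1) v (n + 1 - i) y =
      x * v y + v x * y + ∑ i ∈ Finset.Icc 1 n, u i x * u (n + 1 - i) y := by
  rw [hh_split_sum n (fun i => Function.update u (n + 1) v i x)
    (fun i => Function.update u (n + 1) v i y)]
  have h0 : Function.update u (n + 1) v 0 = LinearMap.id := by
    rw [Function.update_of_ne (by omega), hu0]
  simp only [h0, Function.update_self, LinearMap.id_apply]
  congr 1
  refine Finset.sum_congr rfl fun i hi => ?_
  simp only [Finset.mem_Icc] at hi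
  rw [Function.update_of_ne (by omega), Function.update_of_ne (by omega)]

/-- If `u` satisfies `u(ab)u(c) = u(a)u(bc)` mod `t^{n+1}` for some `n ≥ 1`, then
there exists a `k`-linear `u_{n+1}` making the resulting `u` satisfy the identity mod `t^{n+2}`
iff the obstruction `∑_{i=1}^{n} u_i ∘ u_{n+1-i}` is a coboundary `δ₂(v)` in the higher order
Hochschild complex of `A` over `S²` (i.e. it vanishes in `H³_{S²}(A,A)`). -/
theorem higher_hochschild_deformation_obstruction_vanishes
    {k A : Type*} [Field k] [CommRing A] [Algebra k A]
    (u : ℕ → (A →ₗ[k] A)) (hu0 : u 0 = LinearMap.id) (n : ℕ) (hn : 1 ≤ n)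
    (h : SatisfiesDeformEq u (n + 1)) :
    (∃ v : A →ₗ[k] A, SatisfiesDeformEq (Function.update u (n + 1) v) (n + 2)) ↔
    (∃ v : A →ₗ[k] A, ∀ a b c : A,
      a * b * v c - a * v (b * c) + c * v (a * b) - v a * (b * c) =
        ∑ i ∈ Finset.Icc 1 n,
          (u i (b * c) * u (n + 1 - i) a - u i (a * b) * u (n + 1 - i) c)) := by
  refine exists_congr fun v => ?_
  have key : ∀ a b c : A,
      (a * b * v c - a * v (b * c) + c * v (a * b) - v a * (b * c) =
        ∑ i ∈ Finset.Icc 1 n,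
          (u i (b * c) * u (n + 1 - i) a - u i (a * b) * u (n + 1 - i) c)) ↔
      (∑ i ∈ Finset.range (n + 1 + 1), Function.update u (n + 1) v i (a * b) *
        Function.update u (n + 1) v (n + 1 - i) c =
       ∑ i ∈ Finset.range (n + 1 + 1), Function.update u (n + 1) v i a *
        Function.update u (n + 1) v (n + 1 - i) (b * c)) := by
    intro a b c
    rw [hh_key u hu0, hh_key u hu0, Finset.sum_sub_distrib,
      hh_reflect n (fun i => u i (b * c)) (fun i => u i a)]
    constructor <;> intro e <;> linear_combination e
  constructor
  · intro H a b c
    exact (key a b c).2 (H a b c (n + 1) (by omega))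
  · intro H a b c j hj
    rcases Nat.lt_succ_iff_lt_or_eq.1 hj with hj | rfl
    · have := h a b c j hj
      have e : ∀ i, i ≤ j → Function.update u (n + 1) v i = u i := fun i hi =>
        Function.update_of_ne (by omega) _ _
      convert this using 1 <;>
      · refine Finset.sum_congr rfl fun i hi => ?_
        rw [Finset.mem_range] at hi
        rw [e i (by omega), e (j - i) (by omega)]
    · exact (key a b c).1 (H a b c)
end

section
/- Suppose $u$ satisfies $u(ab)u(c)=u(a)u(bc)$ mod $t^{n+1}$ for some $n\ge1$. Then the obstruction $\omega:A\times A\times A\to A$, $\omega(a,b,c)=\sum_{i=1}^{n}(u_i\circ u_{n+1-i})(a,b,c)$, is a 3-cocycle: $\delta_3(\omega)=0$. -/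
theorem aux_coeff_mul {A : Type*} [CommRing A] (m : ℕ) (V E : PowerSeries A)
    (hE : ∀ j < m, PowerSeries.coeff j E = 0) :
    PowerSeries.coeff m (V * E) = PowerSeries.coeff 0 V * PowerSeries.coeff m E := by
  obtain ⟨F, rfl⟩ := PowerSeries.X_pow_dvd_iff.mpr hE
  rw [show V * (PowerSeries.X ^ m * F) = PowerSeries.X ^ m * (V * F) by ring]
  simp [PowerSeries.coeff_X_pow_mul']

theorem aux_sum {A : Type*} [CommRing A] (f g : ℕ → A) (n : ℕ) :
    PowerSeries.coeff (n + 1) (PowerSeries.mk f * PowerSeries.mk g) =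
      f 0 * g (n + 1) + f (n + 1) * g 0 + ∑ i ∈ Finset.Icc 1 n, f i * g (n + 1 - i) := by
  rw [PowerSeries.coeff_mul, Finset.Nat.sum_antidiagonal_eq_sum_range_succ_mk,
    Finset.sum_range_succ, Finset.range_eq_Ico, Finset.sum_eq_sum_Ico_succ_bot (by omega)]
  have : Finset.Icc 1 n = Finset.Ico (0 + 1) (n + 1) := by ext; simp
  rw [this]
  simp only [PowerSeries.coeff_mk, Nat.sub_zero, Nat.sub_self]
  ring

/-- If `u` satisfies `u(ab)u(c) = u(a)u(bc)` mod `t^{n+1}` for some `n ≥ 1`, then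
the obstruction `ω(a,b,c) = ∑_{i=1}^{n} (u_i ∘ u_{n+1-i})(a,b,c)`, where
`(f ∘ g)(a,b,c) = f(bc)g(a) - f(ab)g(c)`, is a 3-cocycle: `δ₃(ω) = 0`. -/
theorem higher_hochschild_deformation_obstruction_is_cocycle
    {k A : Type*} [Field k] [CommRing A] [Algebra k A]
    (u : ℕ → (A →ₗ[k] A)) (hu0 : u 0 = LinearMap.id) (n : ℕ) (hn : 1 ≤ n)
    (h : SatisfiesDeformEq u (n + 1))
    (ω : A → A → A → A)
    (hω : ∀ a b c : A, ω a b c =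
      ∑ i ∈ Finset.Icc 1 n,
        (u i (b * c) * u (n + 1 - i) a - u i (a * b) * u (n + 1 - i) c)) :
    ∀ a12 a13 a14 a23 a24 a34 : A,
      a12 * a13 * a14 * ω a23 a24 a34
        - a12 * ω (a13 * a23) (a14 * a24) a34
        + a23 * ω (a12 * a13) a14 (a24 * a34)
        - a34 * ω a12 (a13 * a14) (a23 * a24)
        + a14 * a24 * a34 * ω a12 a13 a23 = 0 := by
  intro a b c d e f
  let U : A → PowerSeries A := fun a => PowerSeries.mk (fun i => u i a)
  let E : A → A → A → PowerSeries A := fun a b c => U (b * c) * U a - U (a * b) * U c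
  have hU0 : ∀ a, PowerSeries.coeff 0 (U a) = a := by
    intro a
    simp only [U, PowerSeries.coeff_mk, hu0, LinearMap.id_apply]
  have hE : ∀ a b c, ∀ j < n + 1, PowerSeries.coeff j (E a b c) = 0 := by
    intro a b c j hj
    have := h a b c j hj
    simp only [E, U]
    rw [mul_comm (PowerSeries.mk _), map_sub, PowerSeries.coeff_mul, PowerSeries.coeff_mul,
      Finset.Nat.sum_antidiagonal_eq_sum_range_succ_mk,
      Finset.Nat.sum_antidiagonal_eq_sum_range_succ_mk]
    simp only [PowerSeries.coeff_mk]
    rw [this, sub_self]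
  have hEw : ∀ a b c, PowerSeries.coeff (n + 1) (E a b c) = ω a b c
      + (b * c * u (n + 1) a + u (n + 1) (b * c) * a
        - a * b * u (n + 1) c - u (n + 1) (a * b) * c) := by
    intro a b c
    simp only [E, U]
    rw [map_sub, aux_sum, aux_sum, hω, Finset.sum_sub_distrib]
    simp only [hu0, LinearMap.id_apply]
    ring
  have key : ∀ x a b c, x * ω a b c = PowerSeries.coeff (n + 1) (U x * E a b c)
      - x * (b * c * u (n + 1) a + u (n + 1) (b * c) * a
        - a * b * u (n + 1) c - u (n + 1) (a * b) * c) := by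
    intro x a b c
    rw [aux_coeff_mul _ _ _ (hE a b c), hU0, hEw]
    ring
  have tot : U (a * b * c) * E d e f - U a * E (b * d) (c * e) f + U d * E (a * b) c (e * f)
      - U f * E a (b * c) (d * e) + U (c * e * f) * E a b d = 0 := by
    simp only [E]
    rw [show c * e * f = c * (e * f) by ring, show a * (b * c) = a * b * c by ring,
      show b * d * (c * e) = b * c * (d * e) by ring]
    ring
  have tot' := congrArg (PowerSeries.coeff (n + 1)) tot
  simp only [map_sub, map_add, map_zero] at tot'
  rw [key, key, key, key, key]
  rw [show c * e * f = c * (e * f) by ring, show a * (b * c) = a * b * c by ring,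
      show b * d * (c * e) = b * c * (d * e) by ring] at *
  linear_combination tot'
end

section
/- For all $f\in C^n$, $g\in C^m$, $h\in C^p$ and all indices $1\le i<j\le n$, one has the operad identity $(f\circ_j h)\circ_i g=(f\circ_i g)\circ_{m+j-1} h$ in $C^{n+m+p-2}$. -/
/-- An `S²`-cochain of degree `n` is (encoded as) a function on arrays `(ℕ → ℕ → A)` that only
depends on the triangular part of entries `(p, q)` with `1 ≤ p < q ≤ n`. -/
def IsCochain {A : Type*} (n : ℕ) (f : (ℕ → ℕ → A) → A) : Prop :=
  ∀ a b : ℕ → ℕ → A, (∀ p q : ℕ, 1 ≤ p → p < q → q ≤ n → a p q = b p q) → f a = f b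

/-- The operadic composition `f ∘ᵢ g` of an `S²`-cochain `f` of degree `n` with a cochain `g` of
degree `m` at position `1 ≤ i ≤ n`, a cochain of degree `n + m - 1`:
`(f ∘ᵢ g)(a) = f(b) · g((a_{p+i-1,q+i-1})_{1 ≤ p < q ≤ m})`, where `b` collapses the rows and
columns `i, …, i+m-1` of `a` by the operations `H` (products along rows) and `V` (products along
columns). -/
def circAt {A : Type*} [CommRing A] (f g : (ℕ → ℕ → A) → A) (m i : ℕ) :
    (ℕ → ℕ → A) → A := fun a =>
  f (fun p q =>
      if q < i then a p q
      else if p < i ∧ q = i then ∏ t ∈ Finset.Icc i (i + m - 1), a p t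
      else if p < i ∧ i < q then a p (q + m - 1)
      else if p = i ∧ i < q then ∏ t ∈ Finset.Icc i (i + m - 1), a t (q + m - 1)
      else a (p + m - 1) (q + m - 1)) *
    g (fun p q => a (p + i - 1) (q + i - 1))

theorem prod_Icc_shift_aux {A : Type*} [CommRing A] (F : ℕ → A) (m p j : ℕ) (hm : 1 ≤ m)
    (hp : 1 ≤ p) :
    ∏ t ∈ Finset.Icc j (j + p - 1), F (t + m - 1)
      = ∏ t ∈ Finset.Icc (m + j - 1) (m + j - 1 + p - 1), F t := by
  refine Finset.prod_bij (fun t _ => t + m - 1) ?_ ?_ ?_ ?_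
  · intro t ht
    simp only [Finset.mem_Icc] at ht ⊢
    omega
  · intro s hs t ht hst
    omega
  · intro t ht
    simp only [Finset.mem_Icc] at ht
    refine ⟨t + 1 - m, ?_, ?_⟩
    · simp only [Finset.mem_Icc]
      omega
    · omega
  · intro t ht
    rfl

def collAux {A : Type*} [CommRing A] (m i : ℕ) (a : ℕ → ℕ → A) : ℕ → ℕ → A := fun p q =>
      if q < i then a p q
      else if p < i ∧ q = i then ∏ t ∈ Finset.Icc i (i + m - 1), a p t
      else if p < i ∧ i < q then a p (q + m - 1)
      else if p = i ∧ i < q then ∏ t ∈ Finset.Icc i (i + m - 1), a t (q + m - 1)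
      else a (p + m - 1) (q + m - 1)

section
variable {A : Type*} [CommRing A] (m i : ℕ) (a : ℕ → ℕ → A) (p q : ℕ)

theorem coll1 (h : q < i) : collAux m i a p q = a p q := by
  simp [collAux, h]
theorem coll2 (h : p < i) (h' : q = i) :
    collAux m i a p q = ∏ t ∈ Finset.Icc i (i + m - 1), a p t := by
  unfold collAux; rw [if_neg (by omega), if_pos (by omega)]
theorem coll3 (h : p < i) (h' : i < q) : collAux m i a p q = a p (q + m - 1) := by
  unfold collAux; rw [if_neg (by omega), if_neg (by omega), if_pos (by omega)]
theorem coll4 (h : p = i) (h' : i < q) :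
    collAux m i a p q = ∏ t ∈ Finset.Icc i (i + m - 1), a t (q + m - 1) := by
  unfold collAux; rw [if_neg (by omega), if_neg (by omega), if_neg (by omega), if_pos (by omega)]
theorem coll5 (h : i < p) (h' : i < q) :
    collAux m i a p q = a (p + m - 1) (q + m - 1) := by
  unfold collAux; rw [if_neg (by omega), if_neg (by omega), if_neg (by omega), if_neg (by omega)]
end

theorem coll_comm {A : Type*} [CommRing A] (m p i j : ℕ) (hm : 1 ≤ m) (hp : 1 ≤ p)
    (hij : i < j) (a : ℕ → ℕ → A) (x y : ℕ) (hxy : x < y) :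
    collAux p j (collAux m i a) x y = collAux m i (collAux p (m + j - 1) a) x y := by
  have e1 : y + m - 1 + p - 1 = y + p - 1 + m - 1 := by omega
  have e2 : x + m - 1 + p - 1 = x + p - 1 + m - 1 := by omega
  rcases lt_trichotomy y j with hy | hy | hy
  · rw [coll1 p j _ x y hy]
    rcases lt_trichotomy y i with h1 | h1 | h1
    · rw [coll1 m i _ x y h1, coll1 m i _ x y h1, coll1 _ _ _ _ _ (by omega)]
    · rw [coll2 m i _ x y (by omega) h1, coll2 m i _ x y (by omega) h1]
      refine Finset.prod_congr rfl fun t ht => ?_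
      rw [Finset.mem_Icc] at ht
      rw [coll1 _ _ _ _ _ (by omega)]
    · rcases lt_trichotomy x i with h2 | h2 | h2
      · rw [coll3 m i _ x y h2 h1, coll3 m i _ x y h2 h1, coll1 _ _ _ _ _ (by omega)]
      · rw [coll4 m i _ x y h2 h1, coll4 m i _ x y h2 h1]
        refine Finset.prod_congr rfl fun t ht => ?_
        rw [coll1 _ _ _ _ _ (by omega)]
      · rw [coll5 m i _ x y h2 h1, coll5 m i _ x y h2 h1, coll1 _ _ _ _ _ (by omega)]
  · rw [coll2 p j _ x y (by omega) hy]
    rcases lt_trichotomy x i with h2 | h2 | h2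
    · rw [coll3 m i _ x y h2 (by omega), coll2 _ _ _ _ _ (by omega) (by omega),
        ← prod_Icc_shift_aux _ m p j hm hp]
      refine Finset.prod_congr rfl fun t ht => ?_
      rw [Finset.mem_Icc] at ht
      rw [coll3 _ _ _ _ _ (by omega) (by omega)]
    · rw [coll4 m i _ x y h2 (by omega)]
      have : ∀ t ∈ Finset.Icc i (i + m - 1), collAux p (m + j - 1) a t (y + m - 1)
          = ∏ s ∈ Finset.Icc j (j + p - 1), a t (s + m - 1) := by
        intro t ht
        rw [Finset.mem_Icc] at ht
        rw [coll2 _ _ _ _ _ (by omega) (by omega), ← prod_Icc_shift_aux _ m p j hm hp]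
      rw [Finset.prod_congr rfl this, Finset.prod_comm]
      refine Finset.prod_congr rfl fun t ht => ?_
      rw [Finset.mem_Icc] at ht
      rw [coll4 _ _ _ _ _ (by omega) (by omega)]
    · rw [coll5 m i _ x y h2 (by omega), coll2 _ _ _ _ _ (by omega) (by omega),
        ← prod_Icc_shift_aux _ m p j hm hp]
      refine Finset.prod_congr rfl fun t ht => ?_
      rw [Finset.mem_Icc] at ht
      rw [coll5 _ _ _ _ _ (by omega) (by omega)]
  · rcases lt_trichotomy x j with hx | hx | hx
    · rw [coll3 p j _ x y hx hy]
      rcases lt_trichotomy x i with h2 | h2 | h2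
      · rw [coll3 m i _ _ _ h2 (by omega), coll3 m i _ _ _ h2 (by omega),
          coll3 _ _ _ _ _ (by omega) (by omega), e1]
      · rw [coll4 m i _ _ _ h2 (by omega), coll4 m i _ _ _ h2 (by omega)]
        refine Finset.prod_congr rfl fun t ht => ?_
        rw [Finset.mem_Icc] at ht
        rw [coll3 _ _ _ _ _ (by omega) (by omega), e1]
      · rw [coll5 m i _ _ _ h2 (by omega), coll5 m i _ _ _ h2 (by omega),
          coll3 _ _ _ _ _ (by omega) (by omega), e1]
    · rw [coll4 p j _ x y hx hy, coll5 m i _ _ _ (by omega) (by omega),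
        coll4 _ _ _ _ _ (by omega) (by omega),
        ← prod_Icc_shift_aux (fun t => a t (y + m - 1 + p - 1)) m p j hm hp]
      refine Finset.prod_congr rfl fun t ht => ?_
      rw [Finset.mem_Icc] at ht
      rw [coll5 _ _ _ _ _ (by omega) (by omega), e1]
    · rw [coll5 p j _ x y hx hy, coll5 m i _ _ _ (by omega) (by omega),
        coll5 m i _ _ _ (by omega) (by omega), coll5 _ _ _ _ _ (by omega) (by omega), e1, e2]

/-- the first operad identity `(f ∘ⱼ h) ∘ᵢ g = (f ∘ᵢ g) ∘_{m+j-1} h` for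
`S²`-cochains `f ∈ Cⁿ`, `g ∈ Cᵐ`, `h ∈ Cᵖ` and indices `1 ≤ i < j ≤ n`, an equality of
cochains in `C^{n+m+p-2}`. -/
theorem circAt_operad_identity_disjoint {A : Type*} [CommRing A]
    (n m p : ℕ) (hn : 1 ≤ n) (hm : 1 ≤ m) (hp : 1 ≤ p)
    (f g h : (ℕ → ℕ → A) → A)
    (hf : IsCochain n f) (hg : IsCochain m g) (hh : IsCochain p h)
    (i j : ℕ) (hi : 1 ≤ i) (hij : i < j) (hj : j ≤ n) :
    ∀ a : ℕ → ℕ → A,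
      circAt (circAt f h p j) g m i a = circAt (circAt f g m i) h p (m + j - 1) a := by
  intro a
  change f (collAux p j (collAux m i a)) * h (fun x y => collAux m i a (x + j - 1) (y + j - 1))
      * g (fun x y => a (x + i - 1) (y + i - 1))
    = f (collAux m i (collAux p (m + j - 1) a))
      * g (fun x y => collAux p (m + j - 1) a (x + i - 1) (y + i - 1))
      * h (fun x y => a (x + (m + j - 1) - 1) (y + (m + j - 1) - 1))
  have h1 : f (collAux p j (collAux m i a)) = f (collAux m i (collAux p (m + j - 1) a)) :=
    hf _ _ fun x y _ hxy _ => coll_comm m p i j hm hp hij a x y hxy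
  have h2 : h (fun x y => collAux m i a (x + j - 1) (y + j - 1))
      = h (fun x y => a (x + (m + j - 1) - 1) (y + (m + j - 1) - 1)) := by
    refine hh _ _ fun x y hx hxy _ => ?_
    rw [coll5 _ _ _ _ _ (by omega) (by omega)]
    congr 1 <;> omega
  have h3 : g (fun x y => collAux p (m + j - 1) a (x + i - 1) (y + i - 1))
      = g (fun x y => a (x + i - 1) (y + i - 1)) := by
    refine hg _ _ fun x y hx hxy hy => ?_
    rw [coll1 _ _ _ _ _ (by omega)]
  rw [h1, h2, h3]
  ring
end

section
/- For all $f\in C^n$, $g\in C^m$, $h\in C^p$ and all indices $1\le i\le n$, $1\le j\le m$, one has the operad identity $(f\circ_i g)\circ_{i+j-1} h=f\circ_i(g\circ_j h)$ in $C^{n+m+p-2}$. -/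
theorem prod_Icc_eq_range_aux {A : Type*} [CommRing A] (F : ℕ → A) (i m : ℕ) :
    ∏ t ∈ Finset.Icc i (i + (m + 1) - 1), F t = ∏ t ∈ Finset.range (m + 1), F (i + t) := by
  have : Finset.Icc i (i + (m + 1) - 1) = Finset.Ico i (i + (m + 1)) := by
    ext x; simp only [Finset.mem_Icc, Finset.mem_Ico]; omega
  rw [this, Finset.prod_Ico_eq_prod_range]
  simp

theorem prod_collapse_aux {A : Type*} [CommRing A] (F G : ℕ → A) (i j m p : ℕ)
    (hi : 1 ≤ i) (hm : 1 ≤ m) (hp : 1 ≤ p) (hj : 1 ≤ j) (hjm : j ≤ m)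
    (h1 : ∀ t, i ≤ t → t < i + j - 1 → G t = F t)
    (h2 : G (i + j - 1) = ∏ t ∈ Finset.Icc (i + j - 1) (i + j - 1 + p - 1), F t)
    (h3 : ∀ t, i + j - 1 < t → G t = F (t + p - 1)) :
    ∏ t ∈ Finset.Icc i (i + m - 1), G t
      = ∏ t ∈ Finset.Icc i (i + (m + p - 1) - 1), F t := by
  obtain ⟨j, rfl⟩ := Nat.exists_eq_add_of_le' hj
  obtain ⟨p, rfl⟩ := Nat.exists_eq_add_of_le' hp
  obtain ⟨r, rfl⟩ := Nat.exists_eq_add_of_le hjm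
  have e1 : j + 1 + r = (j + r) + 1 := by omega
  have e2 : j + 1 + r + (p + 1) - 1 = (j + r + p) + 1 := by omega
  rw [e2, e1, prod_Icc_eq_range_aux, prod_Icc_eq_range_aux]
  rw [prod_Icc_eq_range_aux] at h2
  have e3 : j + r + 1 = j + (1 + r) := by omega
  have e4 : j + r + p + 1 = j + ((p + 1) + r) := by omega
  rw [e3, e4, Finset.prod_range_add, Finset.prod_range_add, Finset.prod_range_add,
    Finset.prod_range_add]
  congr 1
  · refine Finset.prod_congr rfl fun t ht => ?_
    rw [Finset.mem_range] at ht
    exact h1 _ (by omega) (by omega)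
  · congr 1
    · rw [Finset.prod_range_one]
      have : i + (j + 0) = i + (j + 1) - 1 := by omega
      rw [this, h2]
      refine Finset.prod_congr rfl fun t _ => ?_
      congr 1; omega
    · refine Finset.prod_congr rfl fun t _ => ?_
      rw [h3 _ (by omega)]
      congr 1; omega

theorem prod_shift_aux {A : Type*} [CommRing A] (F G : ℕ → A) (i j p : ℕ) (hp : 1 ≤ p)
    (h : ∀ t, F (i + t) = G (j + t)) :
    ∏ t ∈ Finset.Icc i (i + p - 1), F t = ∏ t ∈ Finset.Icc j (j + p - 1), G t := by
  obtain ⟨p, rfl⟩ := Nat.exists_eq_add_of_le' hp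
  rw [prod_Icc_eq_range_aux, prod_Icc_eq_range_aux]
  exact Finset.prod_congr rfl fun t _ => h t

/-- the second operad identity `(f ∘ᵢ g) ∘_{i+j-1} h = f ∘ᵢ (g ∘ⱼ h)` for
`S²`-cochains `f ∈ Cⁿ`, `g ∈ Cᵐ`, `h ∈ Cᵖ` and indices `1 ≤ i ≤ n`, `1 ≤ j ≤ m`, an equality
of cochains in `C^{n+m+p-2}`. -/
theorem circAt_operad_identity_nested {A : Type*} [CommRing A]
    (n m p : ℕ) (hn : 1 ≤ n) (hm : 1 ≤ m) (hp : 1 ≤ p)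
    (f g h : (ℕ → ℕ → A) → A)
    (hf : IsCochain n f) (hg : IsCochain m g) (hh : IsCochain p h)
    (i j : ℕ) (hi : 1 ≤ i) (hin : i ≤ n) (hj : 1 ≤ j) (hjm : j ≤ m) :
    ∀ a : ℕ → ℕ → A,
      circAt (circAt f g m i) h p (i + j - 1) a = circAt f (circAt g h p j) (m + p - 1) i a := by
  intro a
  unfold circAt
  rw [mul_assoc]
  congr 1
  · apply hf
    intro x y hx hxy hy
    dsimp only
    rcases lt_trichotomy y i with hyi | hyi | hyi
    · rw [if_pos hyi, if_pos hyi, if_pos (by omega)]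
    · have hxi : x < i := by omega
      rw [if_neg (by omega), if_pos ⟨hxi, hyi⟩, if_neg (by omega), if_pos ⟨hxi, hyi⟩]
      apply prod_collapse_aux (fun t => a x t) _ i j m p hi hm hp hj hjm
      · intro t _ ht
        rw [if_pos ht]
      · rw [if_neg (by omega), if_pos ⟨by omega, rfl⟩]
      · intro t ht
        rw [if_neg (by omega), if_neg (by omega), if_pos ⟨by omega, ht⟩]
    · rw [if_neg (by omega), if_neg (by omega), if_neg (by omega : ¬ y < i),
        if_neg (by omega : ¬ (x < i ∧ y = i))]
      have ey : y + m - 1 + p - 1 = y + (m + p - 1) - 1 := by omega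
      rcases lt_trichotomy x i with hxi | hxi | hxi
      · have hc : x < i ∧ i < y := ⟨hxi, hyi⟩
        simp only [if_pos hc]
        rw [if_neg (by omega), if_neg (by omega), if_pos (by omega), ey]
      · rw [if_neg (by omega), if_pos ⟨hxi, hyi⟩, if_neg (by omega : ¬ (x < i ∧ i < y)),
          if_pos ⟨hxi, hyi⟩]
        apply prod_collapse_aux (fun t => a t (y + (m + p - 1) - 1)) _ i j m p hi hm hp hj hjm
        · intro t _ ht
          rw [if_neg (by omega), if_neg (by omega), if_pos (by omega), ey]
        · rw [if_neg (by omega), if_neg (by omega), if_neg (by omega), if_pos (by omega), ey]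
        · intro t ht
          rw [if_neg (by omega), if_neg (by omega), if_neg (by omega), if_neg (by omega), ey]
      · rw [if_neg (by omega), if_neg (by omega), if_neg (by omega), if_neg (by omega),
          if_neg (by omega), if_neg (by omega), if_neg (by omega : ¬ (x < i ∧ i < y)),
          if_neg (by omega : ¬ (x = i ∧ i < y)), ey]
        congr 1; omega
  · congr 1
    · apply hg
      intro x y hx hxy hy
      dsimp only
      rcases lt_trichotomy y j with hyj | hyj | hyj
      · rw [if_pos (by omega), if_pos hyj]
      · rw [if_neg (by omega), if_pos (by omega), if_neg (by omega), if_pos (by omega)]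
        apply prod_shift_aux _ _ _ _ _ hp
        intro t
        congr 1; omega
      · have ey : y + i - 1 + p - 1 = y + p - 1 + i - 1 := by omega
        rw [if_neg (by omega), if_neg (by omega), if_neg (by omega : ¬ y < j),
          if_neg (by omega : ¬ (x < j ∧ y = j))]
        rcases lt_trichotomy x j with hxj | hxj | hxj
        · rw [if_pos (by omega), if_pos (by omega), ey]
        · rw [if_neg (by omega), if_pos (by omega), if_neg (by omega), if_pos (by omega), ey]
          apply prod_shift_aux _ _ _ _ _ hp
          intro t
          congr 1; omega
        · rw [if_neg (by omega), if_neg (by omega), if_neg (by omega), if_neg (by omega), ey]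
          congr 1; omega
    · apply hh
      intro x y hx hxy hy
      have e1 : x + (i + j - 1) - 1 = x + j - 1 + i - 1 := by omega
      have e2 : y + (i + j - 1) - 1 = y + j - 1 + i - 1 := by omega
      dsimp only
      rw [e1, e2]
end

section
/- Let $\mathfrak{m}\in C^2$ be defined by $\mathfrak{m}((a_{1,2}))=a_{1,2}$. Then for every $f\in C^n$ one has $\delta_n(f)=(-1)^{n-1}\Big(\mathfrak{m}\circ_1 f+(-1)^{n-1}\,\mathfrak{m}\circ_2 f-(-1)^{n-1}\sum_{i=1}^{n}(-1)^{i-1}f\circ_i\mathfrak{m}\Big)$; that is, the higher order Hochschild differential over $S^2$ coincides up to the sign $(-1)^{n-1}$ with the operadic differential $d(f)=\mathfrak{m}\circ f-(-1)^{n-1}f\circ\mathfrak{m}$ induced by the multiplication $\mathfrak{m}$. -/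
/-- The higher order Hochschild differential over `S²`: for a cochain `f` of degree `n`,
`δₙ(f)` is the cochain of degree `n + 1` given by the formula (4) of the paper. -/
def deltaS2 {A : Type*} [CommRing A] (n : ℕ) (f : (ℕ → ℕ → A) → A) :
    (ℕ → ℕ → A) → A := fun a =>
  (∏ j ∈ Finset.Icc 2 (n + 1), a 1 j) * f (fun p q => a (p + 1) (q + 1)) +
    (∑ i ∈ Finset.Icc 1 n, (-1 : A) ^ i * (a i (i + 1) *
      f (fun p q =>
        if q < i then a p q
        else if p < i ∧ q = i then a p i * a p (i + 1)
        else if p < i ∧ i < q then a p (q + 1)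
        else if p = i ∧ i < q then a i (q + 1) * a (i + 1) (q + 1)
        else a (p + 1) (q + 1)))) +
    (-1 : A) ^ (n + 1) * (∏ j ∈ Finset.Icc 1 n, a j (n + 1)) * f a

/-- for the multiplication `𝔪 ∈ C²`, `𝔪((a_{1,2})) = a_{1,2}`, the higher order
Hochschild differential over `S²` coincides up to the sign `(-1)^{n-1}` with the operadic
differential `d(f) = 𝔪 ∘ f - (-1)^{n-1} f ∘ 𝔪`:
`δₙ(f) = (-1)^{n-1} (𝔪 ∘₁ f + (-1)^{n-1} 𝔪 ∘₂ f - (-1)^{n-1} ∑_{i=1}^{n} (-1)^{i-1} f ∘ᵢ 𝔪)`. -/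
theorem deltaS2_eq_operadic_differential {A : Type*} [CommRing A]
    (n : ℕ) (hn : 1 ≤ n) (f : (ℕ → ℕ → A) → A) (hf : IsCochain n f) :
    ∀ a : ℕ → ℕ → A,
      deltaS2 n f a =
        (-1 : A) ^ (n - 1) *
          (circAt (fun b => b 1 2) f n 1 a + (-1 : A) ^ (n - 1) * circAt (fun b => b 1 2) f n 2 a -
            (-1 : A) ^ (n - 1) *
              ∑ i ∈ Finset.Icc 1 n, (-1 : A) ^ (i - 1) * circAt f (fun b => b 1 2) 2 i a) := by
  intro a
  obtain ⟨k, rfl⟩ : ∃ k, n = k + 1 := ⟨n - 1, by omega⟩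
  have hs : (-1 : A) ^ k * (-1 : A) ^ k = 1 := by
    rw [← mul_pow]; simp
  have h1 : circAt (fun b => b 1 2) f (k + 1) 1 a =
      (∏ j ∈ Finset.Icc 1 (k + 1), a j (k + 1 + 1)) * f a := by
    have e : 2 + (k + 1) - 1 = k + 1 + 1 := by omega
    have e' : 1 + (k + 1) - 1 = k + 1 := by omega
    simp [circAt, e, e']
  have h2 : circAt (fun b => b 1 2) f (k + 1) 2 a =
      (∏ j ∈ Finset.Icc 2 (k + 1 + 1), a 1 j) * f (fun p q => a (p + 1) (q + 1)) := by
    have e : 2 + (k + 1) - 1 = k + 1 + 1 := by omega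
    simp [circAt, e]
  have h3 : ∑ i ∈ Finset.Icc 1 (k + 1), (-1 : A) ^ i * (a i (i + 1) *
      f (fun p q =>
        if q < i then a p q
        else if p < i ∧ q = i then a p i * a p (i + 1)
        else if p < i ∧ i < q then a p (q + 1)
        else if p = i ∧ i < q then a i (q + 1) * a (i + 1) (q + 1)
        else a (p + 1) (q + 1))) =
      - ∑ i ∈ Finset.Icc 1 (k + 1), (-1 : A) ^ (i - 1) * circAt f (fun b => b 1 2) 2 i a := by
    rw [← Finset.sum_neg_distrib]
    refine Finset.sum_congr rfl fun i hi => ?_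
    obtain ⟨j, rfl⟩ : ∃ j, i = j + 1 := ⟨i - 1, by
      have := (Finset.mem_Icc.mp hi).1
      omega⟩
    have e0 : j + 1 + 2 - 1 = j + 1 + 1 := by omega
    have e1 : 1 + (j + 1) - 1 = j + 1 := by omega
    have e2 : 2 + (j + 1) - 1 = j + 1 + 1 := by omega
    have e3 : ∀ x : ℕ, x + 2 - 1 = x + 1 := fun x => by omega
    have hp : ∀ g : ℕ → A, ∏ t ∈ Finset.Icc (j + 1) (j + 1 + 1), g t =
        g (j + 1) * g (j + 1 + 1) := by
      intro g
      rw [Finset.prod_Icc_succ_top (by omega)]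
      simp
    simp only [circAt, e1, e2, e3, hp, Nat.add_sub_cancel]
    rw [pow_succ]
    ring
  rw [h1, h2]
  unfold deltaS2
  rw [h3, Nat.add_sub_cancel]
  generalize f (fun p q => a (p + 1) (q + 1)) = F
  generalize (∑ i ∈ Finset.Icc 1 (k + 1), (-1 : A) ^ (i - 1) * circAt f (fun b => b 1 2) 2 i a) = S
  generalize (∏ j ∈ Finset.Icc 2 (k + 1 + 1), a 1 j) = P
  rw [pow_succ, pow_succ]
  linear_combination (S - P * F) * hs
end

section
/- For every $f\in C^n$ one has $\delta_{n+1}(\delta_n(f))=0$; that is, $(C^*,\delta)$ is a cochain complex (the higher order Hochschild complex of $A$ over $S^2$). -/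
def DD {A : Type*} [CommRing A] (i : ℕ) (a : ℕ → ℕ → A) : ℕ → ℕ → A := fun p q =>
        if q < i then a p q
        else if p < i ∧ q = i then a p i * a p (i + 1)
        else if p < i ∧ i < q then a p (q + 1)
        else if p = i ∧ i < q then a i (q + 1) * a (i + 1) (q + 1)
        else a (p + 1) (q + 1)

def WW {A : Type*} [CommRing A] (n i : ℕ) (a : ℕ → ℕ → A) : A :=
  if i = 0 then ∏ j ∈ Finset.Icc 2 (n + 1), a 1 j
  else if i = n + 1 then ∏ j ∈ Finset.Icc 1 n, a j (n + 1)
  else a i (i + 1)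

lemma delta_eq {A : Type*} [CommRing A] (n : ℕ) (f : (ℕ → ℕ → A) → A) (hf : IsCochain n f)
    (a : ℕ → ℕ → A) :
    deltaS2 n f a = ∑ i ∈ Finset.range (n + 2), (-1 : A) ^ i * (WW n i a * f (DD i a)) := by
  have h0 : f (fun p q => a (p + 1) (q + 1)) = f (DD 0 a) := by
    apply hf
    intro p q h1 h2 h3
    unfold DD
    grind
  have h1 : f a = f (DD (n + 1) a) := by
    apply hf
    intro p q h1 h2 h3
    unfold DD
    grind
  rw [Finset.sum_range_succ, Finset.sum_range_succ', add_comm (Finset.sum _ _)]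
  unfold deltaS2
  rw [h0, ← h1]
  congr 1
  · congr 1
    · simp [WW]
    · rw [Finset.range_eq_Ico, Finset.sum_Ico_add' (fun i => (-1 : A) ^ i * (WW n i a * f (DD i a)))]
      refine Finset.sum_congr (by ext; simp; try omega) ?_
      intro i hi
      have : WW n i a = a i (i + 1) := by
        simp at hi
        unfold WW
        rw [if_neg (by omega), if_neg (by omega)]
      rw [this]
      rfl
  · simp [WW, mul_assoc]

lemma delta_cochain {A : Type*} [CommRing A] (n : ℕ) (f : (ℕ → ℕ → A) → A) (hf : IsCochain n f) :
    IsCochain (n + 1) (deltaS2 n f) := by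
  intro a b hab
  rw [delta_eq n f hf, delta_eq n f hf]
  refine Finset.sum_congr rfl ?_
  intro i hi
  simp at hi
  congr 2
  · unfold WW
    split_ifs with h1 h2
    · refine Finset.prod_congr rfl ?_
      intro j hj
      simp at hj
      apply hab <;> omega
    · refine Finset.prod_congr rfl ?_
      intro j hj
      simp at hj
      apply hab <;> omega
    · apply hab <;> omega
  · apply hf
    intro p q h1 h2 h3
    unfold DD
    grind

lemma alt_sum {A : Type*} [CommRing A] (m : ℕ) (F : ℕ → ℕ → A)
    (h : ∀ i k, i ≤ k → k < m → F (k + 1) i = F i k) :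
    ∑ j ∈ Finset.range (m + 1), ∑ i ∈ Finset.range m, (-1 : A) ^ j * ((-1 : A) ^ i * F j i) = 0 := by
  rw [← Finset.sum_product']
  refine Finset.sum_involution
    (fun x _ => if x.2 < x.1 then (x.2, x.1 - 1) else (x.2 + 1, x.1)) ?_ ?_ ?_ ?_
  · rintro ⟨j, i⟩ hx
    simp at hx
    dsimp only
    split_ifs with hij
    · obtain ⟨k, rfl⟩ : ∃ k, j = k + 1 := ⟨j - 1, by omega⟩
      simp only [Nat.add_sub_cancel]
      rw [h i k (by omega) (by omega)]
      ring
    · rw [h j i (by omega) (by omega)]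
      ring
  · rintro ⟨j, i⟩ hx _
    dsimp only
    split_ifs <;> simp <;> omega
  · rintro ⟨j, i⟩ hx
    simp at hx
    dsimp only
    split_ifs <;> simp <;> omega
  · rintro ⟨j, i⟩ hx
    dsimp only
    split_ifs <;> simp <;> grind

lemma merge {A : Type*} [CommRing A] (s n m : ℕ) (g G : ℕ → A) (h1 : s ≤ m) (h2 : m ≤ n)
    (ha : ∀ j, s ≤ j → j < m → G j = g j) (hb : G m = g m * g (m + 1))
    (hc : ∀ j, m < j → j ≤ n → G j = g (j + 1)) :
    ∏ j ∈ Finset.Icc s n, G j = ∏ j ∈ Finset.Icc s (n + 1), g j := by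
  induction n, h2 using Nat.le_induction with
  | base =>
    rw [Finset.prod_Icc_succ_top (by omega)]
    obtain rfl | h := Nat.eq_or_lt_of_le h1
    · simp [hb]
    · obtain ⟨k, rfl⟩ : ∃ k, m = k + 1 := ⟨m - 1, by omega⟩
      rw [Finset.prod_Icc_succ_top (by omega), Finset.prod_Icc_succ_top (by omega), hb, mul_assoc]
      congr 1
      refine Finset.prod_congr rfl ?_
      intro j hj
      simp at hj
      apply ha <;> omega
  | succ n hn ih =>
    rw [Finset.prod_Icc_succ_top (by omega), Finset.prod_Icc_succ_top (by omega),
      ih (fun j hj hj' => hc j hj (by omega)), hc (n + 1) (by omega) (by omega)]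

lemma prod_bot {A : Type*} [CommRing A] (s n : ℕ) (h : s ≤ n + 1) (g : ℕ → A) :
    ∏ j ∈ Finset.Icc s (n + 1), g j = g s * ∏ j ∈ Finset.Icc s n, g (j + 1) := by
  have e1 : Finset.Icc s (n + 1) = Finset.Ico s (n + 2) := by ext; simp; omega
  have e2 : Finset.Icc s n = Finset.Ico s (n + 1) := by ext; simp; try omega
  rw [e1, e2, Finset.prod_eq_prod_Ico_succ_bot (by omega),
    Finset.prod_Ico_add']

lemma DD_comm {A : Type*} [CommRing A] (i k : ℕ) (h : i ≤ k) (a : ℕ → ℕ → A) (p q : ℕ)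
    (hp : 1 ≤ p) (hq : p < q) : DD i (DD (k + 1) a) p q = DD k (DD i a) p q := by
  rcases lt_trichotomy p i with h1 | h1 | h1 <;> rcases lt_trichotomy q i with h2 | h2 | h2 <;>
  rcases lt_trichotomy p k with h3 | h3 | h3 <;> rcases lt_trichotomy q k with h4 | h4 | h4 <;>
  first
  | omega
  | (unfold DD
     grind)

lemma WW_comm {A : Type*} [CommRing A] (n i k : ℕ) (hn : 1 ≤ n) (h : i ≤ k) (hk : k < n + 2)
    (a : ℕ → ℕ → A) :
    WW (n + 1) (k + 1) a * WW n i (DD (k + 1) a) = WW (n + 1) i a * WW n k (DD i a) := by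
  rcases Nat.eq_zero_or_pos i with rfl | hi
  · rcases Nat.eq_zero_or_pos k with rfl | hk0
    · have e : ∏ j ∈ Finset.Icc 2 (n + 1), DD 1 a 1 j
          = (∏ j ∈ Finset.Icc 2 (n + 1), a 1 (j + 1)) * ∏ j ∈ Finset.Icc 2 (n + 1), DD 0 a 1 j := by
        rw [← Finset.prod_mul_distrib]
        refine Finset.prod_congr rfl ?_
        intro j hj
        simp at hj
        unfold DD
        grind
      simp only [WW]
      simp only [zero_add, if_true, one_ne_zero, if_false]
      rw [if_neg (by omega), e, prod_bot 2 (n + 1) (by omega)]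
      ring
    · rcases Nat.lt_or_ge k (n + 1) with hk1 | hk1
      · simp only [WW, if_true]
        rw [if_neg (by omega), if_neg (by omega), if_neg (by omega), if_neg (by omega),
          merge 2 (n + 1) (k + 1) (a 1) (DD (k + 1) a 1) (by omega) (by omega)
            (by unfold DD; grind) (by unfold DD; grind) (by unfold DD; grind)]
        have : DD 0 a k (k + 1) = a (k + 1) (k + 1 + 1) := by unfold DD; grind
        rw [this, mul_comm]
      · obtain rfl : k = n + 1 := by omega
        simp only [WW, if_true]
        rw [if_neg (by omega), if_neg (by omega), prod_bot 1 n (by omega),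
          Finset.prod_Icc_succ_top (show 2 ≤ n + 1 + 1 by omega)]
        have e1 : ∏ j ∈ Finset.Icc 2 (n + 1), DD (n + 1 + 1) a 1 j
            = ∏ j ∈ Finset.Icc 2 (n + 1), a 1 j := by
          refine Finset.prod_congr rfl ?_
          intro j hj
          simp at hj
          unfold DD
          grind
        have e2 : ∏ j ∈ Finset.Icc 1 n, DD 0 a j (n + 1)
            = ∏ j ∈ Finset.Icc 1 n, a (j + 1) (n + 1 + 1) := by
          refine Finset.prod_congr rfl ?_
          intro j hj
          simp at hj
          unfold DD
          grind
        rw [e1, e2]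
        ring
  · rcases Nat.lt_or_ge k (n + 1) with hk1 | hk1
    · simp only [WW]
      rw [if_neg (by omega), if_neg (by omega), if_neg (by omega), if_neg (by omega),
        if_neg (by omega), if_neg (by omega), if_neg (by omega), if_neg (by omega)]
      unfold DD
      grind
    · obtain rfl : k = n + 1 := by omega
      rcases Nat.lt_or_ge i (n + 1) with hi1 | hi1
      · simp only [WW, if_true]
        rw [if_neg (by omega), if_neg (by omega), if_neg (by omega), if_neg (by omega),
          if_neg (by omega), if_neg (by omega),
          merge 1 n i (fun j => a j (n + 1 + 1)) (fun j => DD i a j (n + 1)) (by omega) (by omega)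
            (by unfold DD; grind) (by unfold DD; grind) (by unfold DD; grind)]
        have : DD (n + 1 + 1) a i (i + 1) = a i (i + 1) := by unfold DD; grind
        rw [this, mul_comm]
      · obtain rfl : i = n + 1 := by omega
        simp only [WW, if_true]
        rw [if_neg (by omega), if_neg (by omega), if_neg (by omega), if_neg (by omega),
          if_neg (by omega), Finset.prod_Icc_succ_top (show 1 ≤ n + 1 by omega)]
        have e : ∏ j ∈ Finset.Icc 1 n, DD (n + 1) a j (n + 1)
            = (∏ j ∈ Finset.Icc 1 n, a j (n + 1 + 1)) *
              ∏ j ∈ Finset.Icc 1 n, DD (n + 1 + 1) a j (n + 1) := by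
          rw [← Finset.prod_mul_distrib]
          refine Finset.prod_congr rfl ?_
          intro j hj
          simp at hj
          unfold DD
          grind
        rw [e]
        ring

/-- `δ_{n+1} ∘ δₙ = 0`, i.e. `(C*, δ)` is a cochain complex (the higher order
Hochschild complex of `A` over `S²`). -/
theorem deltaS2_deltaS2 {A : Type*} [CommRing A]
    (n : ℕ) (hn : 1 ≤ n) (f : (ℕ → ℕ → A) → A) (hf : IsCochain n f) :
    ∀ a : ℕ → ℕ → A, deltaS2 (n + 1) (deltaS2 n f) a = 0 := by
  intro a
  rw [delta_eq (n + 1) _ (delta_cochain n f hf)]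
  rw [← alt_sum (n + 2) (fun j i => WW (n + 1) j a * WW n i (DD j a) * f (DD i (DD j a)))]
  · refine Finset.sum_congr rfl ?_
    intro j _
    rw [delta_eq n f hf, Finset.mul_sum, Finset.mul_sum]
    refine Finset.sum_congr rfl ?_
    intro i _
    ring
  · intro i k hik hk
    rw [WW_comm n i k hn hik hk]
    congr 1
    apply hf
    intro p q hp hq _
    exact DD_comm i k hik a p q hp hq
end

section
/- The differential is a graded derivation with respect to the cup product: for all $f\in C^n$ and $g\in C^m$, $\delta_{n+m}(f\smile g)=\delta_n(f)\smile g+(-1)^{n}\,f\smile\delta_m(g)$. In particular, the cup product of two cocycles is a cocycle, so the cup product descends to $H^*_{S^2}(A,A)$. -/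
/-- The cup product of `S²`-cochains `f` of degree `n` and `g` of degree `m`, a cochain of
degree `n + m`: `(f ⌣ g)(a) = (∏_{p ≤ n < q} a_{p,q}) · f((a_{p,q})_{p<q≤n}) ·
g((a_{p+n,q+n})_{p<q≤m})`. -/
def cupS2 {A : Type*} [CommRing A] (n m : ℕ) (f g : (ℕ → ℕ → A) → A) :
    (ℕ → ℕ → A) → A := fun a =>
  (∏ p ∈ Finset.Icc 1 n, ∏ q ∈ Finset.Icc (n + 1) (n + m), a p q) *
    f a * g (fun p q => a (p + n) (q + n))

theorem collapse_prod {A : Type*} [CommRing A] (x : ℕ → A) (s i N : ℕ) (hs : s ≤ i) (hN : i ≤ N) :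
    (∏ t ∈ Finset.Icc s N, if t < i then x t else if t = i then x i * x (i + 1) else x (t + 1)) =
      ∏ t ∈ Finset.Icc s (N + 1), x t := by
  induction N, hN using Nat.le_induction with
  | base =>
    rw [Finset.prod_Icc_succ_top (by omega)]
    obtain rfl | h := Nat.eq_zero_or_pos i
    · obtain rfl : s = 0 := by omega
      simp
    · obtain ⟨j, rfl⟩ : ∃ j, i = j + 1 := ⟨i - 1, by omega⟩
      rw [Finset.prod_Icc_succ_top (by omega), Finset.prod_Icc_succ_top (by omega)]
      rw [Finset.prod_congr rfl (g := x)]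
      · simp [mul_assoc]
      · intro t ht
        rw [Finset.mem_Icc] at ht
        rw [if_pos (by omega)]
  | succ N hN ih =>
    rw [Finset.prod_Icc_succ_top (by omega), ih, if_neg (by omega), if_neg (by omega),
      Finset.prod_Icc_succ_top (b := N + 1) (by omega)]

theorem shift_prod {A : Type*} [CommRing A] (x : ℕ → A) (s N c : ℕ) :
    (∏ t ∈ Finset.Icc s N, x (t + c)) = ∏ t ∈ Finset.Icc (s + c) (N + c), x t := by
  rw [← Finset.map_add_right_Icc, Finset.prod_map]
  rfl

theorem bot_prod {A : Type*} [CommRing A] (x : ℕ → A) (s N : ℕ) (h : s ≤ N) :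
    (∏ t ∈ Finset.Icc s N, x t) = x s * ∏ t ∈ Finset.Icc (s + 1) N, x t := by
  rw [← Finset.mul_prod_Ioc_eq_prod_Icc h]
  congr 2
  ext t
  simp only [Finset.mem_Ioc, Finset.mem_Icc]
  omega

theorem split_prod {A : Type*} [CommRing A] (x : ℕ → A) (s k N : ℕ) (h : s ≤ k + 1) (h' : k ≤ N) :
    (∏ t ∈ Finset.Icc s N, x t) =
      (∏ t ∈ Finset.Icc s k, x t) * ∏ t ∈ Finset.Icc (k + 1) N, x t := by
  induction N, h' using Nat.le_induction with
  | base => simp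
  | succ N hN ih =>
    rw [Finset.prod_Icc_succ_top (by omega), Finset.prod_Icc_succ_top (by omega), ih, mul_assoc]

/-- the differential is a graded derivation with respect to the cup product:
`δ_{n+m}(f ⌣ g) = δₙ(f) ⌣ g + (-1)ⁿ f ⌣ δₘ(g)` (so the cup product of cocycles is a cocycle
and the cup product descends to `H*_{S²}(A,A)`). -/
theorem deltaS2_cupS2_leibniz {A : Type*} [CommRing A]
    (n m : ℕ) (hn : 1 ≤ n) (hm : 1 ≤ m)
    (f g : (ℕ → ℕ → A) → A) (hf : IsCochain n f) (hg : IsCochain m g) :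
    ∀ a : ℕ → ℕ → A,
      deltaS2 (n + m) (cupS2 n m f g) a =
        cupS2 (n + 1) m (deltaS2 n f) g a + (-1 : A) ^ n * cupS2 n (m + 1) f (deltaS2 m g) a := by
  intro a
  have hsum : ∀ F : ℕ → A, ∑ i ∈ Finset.Icc 1 (n + m), F i =
      ∑ i ∈ Finset.Icc 1 n, F i + ∑ i ∈ Finset.Icc 1 m, F (i + n) := by
    intro F
    clear hg hm
    induction m with
    | zero => simp
    | succ m ih =>
      rw [← add_assoc, Finset.sum_Icc_succ_top (by omega), Finset.sum_Icc_succ_top (by omega), ih,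
        add_assoc]
      congr 3
      omega
  unfold deltaS2
  rw [hsum]
  unfold cupS2
  simp only [mul_add, add_mul, Finset.mul_sum, Finset.sum_mul]
  -- first term
  have h1 : (∏ j ∈ Finset.Icc 2 (n + m + 1), a 1 j) *
      (∏ p ∈ Finset.Icc 1 n, ∏ q ∈ Finset.Icc (n + 1) (n + m), a (p + 1) (q + 1)) =
      (∏ p ∈ Finset.Icc 1 (n + 1), ∏ q ∈ Finset.Icc (n + 1 + 1) (n + 1 + m), a p q) *
        ∏ j ∈ Finset.Icc 2 (n + 1), a 1 j := by
    rw [split_prod _ 2 (n + 1) _ (by omega) (by omega),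
      bot_prod (fun p => ∏ q ∈ Finset.Icc (n + 1 + 1) (n + 1 + m), a p q) _ _ (by omega),
      ← shift_prod (fun p => ∏ q ∈ Finset.Icc (n + 1 + 1) (n + 1 + m), a p q) 1 n 1,
      show n + 1 + m = n + m + 1 by omega]
    simp only [← shift_prod _ (n + 1) (n + m) 1]
    ring
  have hg1 : g (fun p q => a (p + n + 1) (q + n + 1)) =
      g (fun p q => a (p + (n + 1)) (q + (n + 1))) := rfl
  -- cancelling terms
  have h2 : (∏ p ∈ Finset.Icc 1 (n + 1), ∏ q ∈ Finset.Icc (n + 1 + 1) (n + 1 + m), a p q) *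
      (∏ j ∈ Finset.Icc 1 n, a j (n + 1)) =
      (∏ p ∈ Finset.Icc 1 n, ∏ q ∈ Finset.Icc (n + 1) (n + (m + 1)), a p q) *
      ∏ j ∈ Finset.Icc 2 (m + 1), a (1 + n) (j + n) := by
    rw [Finset.prod_Icc_succ_top (by omega), shift_prod (fun j => a (1 + n) j)]
    simp only [bot_prod _ (n + 1) (n + (m + 1)) (by omega), Finset.prod_mul_distrib]
    rw [show n + 1 + m = n + (m + 1) by omega, show m + 1 + n = n + (m + 1) by omega,
      show 2 + n = n + 1 + 1 by omega, show 1 + n = n + 1 by omega]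
    ring
  have hg2 : g (fun p q => a (p + 1 + n) (q + 1 + n)) =
      g (fun p q => a (p + (n + 1)) (q + (n + 1))) := by
    congr 1; funext p q; congr 1 <;> omega
  -- last term
  have h3 : (∏ j ∈ Finset.Icc 1 (n + m), a j (n + m + 1)) *
      (∏ p ∈ Finset.Icc 1 n, ∏ q ∈ Finset.Icc (n + 1) (n + m), a p q) =
      (∏ p ∈ Finset.Icc 1 n, ∏ q ∈ Finset.Icc (n + 1) (n + (m + 1)), a p q) *
      ∏ j ∈ Finset.Icc 1 m, a (j + n) (m + 1 + n) := by
    rw [shift_prod (fun j => a j (m + 1 + n)), split_prod _ 1 n _ (by omega) (by omega),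
      ← add_assoc n m 1]
    simp only [Finset.prod_Icc_succ_top (a := n + 1) (b := n + m) (by omega),
      Finset.prod_mul_distrib]
    rw [show m + 1 + n = n + m + 1 by omega, show 1 + n = n + 1 by omega,
      show m + n = n + m by omega]
    ring
  rw [hg1, hg2]
  -- sums
  have hS1 : ∀ i ∈ Finset.Icc 1 n, ∀ b : ℕ → ℕ → A, b = (fun p q =>
        if q < i then a p q
        else if p < i ∧ q = i then a p i * a p (i + 1)
        else if p < i ∧ i < q then a p (q + 1)
        else if p = i ∧ i < q then a i (q + 1) * a (i + 1) (q + 1)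
        else a (p + 1) (q + 1)) →
      (∏ p ∈ Finset.Icc 1 n, ∏ q ∈ Finset.Icc (n + 1) (n + m), b p q) =
        (∏ p ∈ Finset.Icc 1 (n + 1), ∏ q ∈ Finset.Icc (n + 1 + 1) (n + 1 + m), a p q) ∧
      g (fun p q => b (p + n) (q + n)) = g (fun p q => a (p + (n + 1)) (q + (n + 1))) := by
    intro i hi b hb
    rw [Finset.mem_Icc] at hi
    constructor
    · rw [← collapse_prod _ 1 i n hi.1 hi.2]
      refine Finset.prod_congr rfl fun p hp => ?_
      rw [show n + 1 + m = n + m + 1 by omega]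
      simp only [← shift_prod _ (n + 1) (n + m) 1]
      rw [← Finset.prod_mul_distrib]
      split_ifs with h h'
      all_goals
        refine Finset.prod_congr rfl fun q hq => ?_
        rw [Finset.mem_Icc] at hq
        subst hb
        grind
    · apply hg
      intro p q hp hpq hq
      subst hb
      grind
  have hS2 : ∀ i ∈ Finset.Icc 1 m, ∀ b : ℕ → ℕ → A, b = (fun p q =>
        if q < i + n then a p q
        else if p < i + n ∧ q = i + n then a p (i + n) * a p (i + n + 1)
        else if p < i + n ∧ i + n < q then a p (q + 1)
        else if p = i + n ∧ i + n < q then a (i + n) (q + 1) * a (i + n + 1) (q + 1)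
        else a (p + 1) (q + 1)) →
      (∏ p ∈ Finset.Icc 1 n, ∏ q ∈ Finset.Icc (n + 1) (n + m), b p q) =
        (∏ p ∈ Finset.Icc 1 n, ∏ q ∈ Finset.Icc (n + 1) (n + (m + 1)), a p q) ∧
      f b = f a ∧
      g (fun p q => b (p + n) (q + n)) = g (fun p q =>
        if q < i then a (p + n) (q + n)
        else if p < i ∧ q = i then a (p + n) (i + n) * a (p + n) (i + 1 + n)
        else if p < i ∧ i < q then a (p + n) (q + 1 + n)
        else if p = i ∧ i < q then a (i + n) (q + 1 + n) * a (i + 1 + n) (q + 1 + n)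
        else a (p + 1 + n) (q + 1 + n)) := by
    intro i hi b hb
    rw [Finset.mem_Icc] at hi
    refine ⟨?_, ?_, ?_⟩
    · refine Finset.prod_congr rfl fun p hp => ?_
      rw [Finset.mem_Icc] at hp
      rw [← add_assoc n m 1, ← collapse_prod _ (n + 1) (i + n) (n + m) (by omega) (by omega)]
      refine Finset.prod_congr rfl fun q hq => ?_
      rw [Finset.mem_Icc] at hq
      subst hb
      grind
    · apply hf
      intro p q hp hpq hq
      subst hb
      grind
    · subst hb
      apply hg
      intro p q hp hpq hq
      simp only [add_lt_add_iff_right, add_left_inj, add_right_comm _ n 1]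
  rw [Finset.sum_congr (s₁ := Finset.Icc 1 n) rfl (fun i hi => by
    rw [(hS1 i hi _ rfl).1, (hS1 i hi _ rfl).2])]
  rw [Finset.sum_congr (s₁ := Finset.Icc 1 m) rfl (fun i hi => by
    rw [(hS2 i hi _ rfl).1, (hS2 i hi _ rfl).2.1, (hS2 i hi _ rfl).2.2])]
  have key : ∀ x1 s1 s2 x3 y1 t1 y3 z1 t2 z3 : A, s1 = t1 → s2 = t2 → x1 = y1 → x3 = z3 →
      y3 + z1 = 0 → x1 + (s1 + s2) + x3 = y1 + t1 + y3 + (z1 + t2 + z3) := by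
    intro x1 s1 s2 x3 y1 t1 y3 z1 t2 z3 e1 e2 e3 e4 e5
    linear_combination e1 + e2 + e3 + e4 - e5
  apply key
  · refine Finset.sum_congr rfl fun i hi => ?_
    ring
  · refine Finset.sum_congr rfl fun i hi => ?_
    rw [show i + n + 1 = i + 1 + n by omega]
    ring
  · linear_combination (f (fun p q => a (p + 1) (q + 1)) *
      g (fun p q => a (p + (n + 1)) (q + (n + 1)))) * h1
  · linear_combination ((-1) ^ (n + m + 1) * f a * g (fun p q => a (p + n) (q + n))) * h3
  · linear_combination ((-1) ^ (n + 1) * f a *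
      g (fun p q => a (p + (n + 1)) (q + (n + 1)))) * h2
end

section
/- The composition $\circ$ on $S^2$-cochains satisfies the graded right pre-Lie identity: for all $f\in C^n$, $g\in C^m$, $h\in C^p$, $(f\circ g)\circ h-f\circ(g\circ h)=(-1)^{(m-1)(p-1)}\big((f\circ h)\circ g-f\circ(h\circ g)\big)$. -/
/-- The (total) composition `f ∘ g = ∑_{i=1}^{n} (-1)^{(i-1)(m-1)} f ∘ᵢ g` of `S²`-cochains of
degrees `n` and `m`, a cochain of degree `n + m - 1`. -/
def circS2 {A : Type*} [CommRing A] (n m : ℕ) (f g : (ℕ → ℕ → A) → A) :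
    (ℕ → ℕ → A) → A := fun a =>
  ∑ i ∈ Finset.Icc 1 n, (-1 : A) ^ ((i - 1) * (m - 1)) * circAt f g m i a

/-- The Gerstenhaber bracket `[f, g] = f ∘ g - (-1)^{(n-1)(m-1)} g ∘ f` of `S²`-cochains of
degrees `n` and `m`, a cochain of degree `n + m - 1`. -/
def brackS2 {A : Type*} [CommRing A] (n m : ℕ) (f g : (ℕ → ℕ → A) → A) :
    (ℕ → ℕ → A) → A := fun a =>
  circS2 n m f g a - (-1 : A) ^ ((n - 1) * (m - 1)) * circS2 m n g f a

namespace S2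

def C {A : Type*} [CommRing A] (m i : ℕ) (a : ℕ → ℕ → A) : ℕ → ℕ → A := fun p q =>
      if q < i then a p q
      else if p < i ∧ q = i then ∏ t ∈ Finset.Icc i (i + m - 1), a p t
      else if p < i ∧ i < q then a p (q + m - 1)
      else if p = i ∧ i < q then ∏ t ∈ Finset.Icc i (i + m - 1), a t (q + m - 1)
      else a (p + m - 1) (q + m - 1)

def S {A : Type*} (i : ℕ) (a : ℕ → ℕ → A) : ℕ → ℕ → A := fun p q => a (p + i - 1) (q + i - 1)

theorem circAt_eq {A : Type*} [CommRing A] (f g : (ℕ → ℕ → A) → A) (m i : ℕ) (a : ℕ → ℕ → A) :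
    circAt f g m i a = f (C m i a) * g (S i a) := rfl

def B (m i x : ℕ) : Finset ℕ :=
  Finset.Icc (if x ≤ i then x else x + m - 1) (if x < i then x else x + m - 1)

def D (m i t : ℕ) : ℕ := if t < i then t else if t < i + m then i else t + 1 - m

theorem mem_B {m : ℕ} (hm : 1 ≤ m) (i x t : ℕ) : t ∈ B m i x ↔ D m i t = x := by
  unfold B D
  rw [Finset.mem_Icc]
  split_ifs <;> omega

theorem C_eq {A : Type*} [CommRing A] {m : ℕ} (hm : 1 ≤ m) (i : ℕ) (a : ℕ → ℕ → A) {x y : ℕ}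
    (hxy : x < y) : C m i a x y = ∏ s ∈ B m i x, ∏ t ∈ B m i y, a s t := by
  unfold C B
  rcases lt_trichotomy y i with h | h | h
  · rw [if_pos h, if_pos (by omega), if_pos (by omega), if_pos (by omega), if_pos (by omega)]
    simp
  · subst h
    simp [hxy, hxy.le]
  · rcases lt_trichotomy x i with h' | h' | h'
    · have h1 : ¬ y < i := by omega
      have h2 : ¬ y ≤ i := by omega
      have h3 : ¬ y = i := by omega
      simp [h, h', h1, h2, h3, h'.le]
    · subst h'
      have h1 : ¬ y < x := by omega
      have h2 : ¬ y ≤ x := by omega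
      simp [h, h1, h2]
    · have h1 : ¬ y < i := by omega
      have h2 : ¬ y ≤ i := by omega
      have h3 : ¬ x < i := by omega
      have h4 : ¬ x ≤ i := by omega
      have h5 : ¬ x = i := by omega
      simp [h1, h2, h3, h4, h5]

theorem prod_B {A : Type*} [CommRing A] {p : ℕ} (hp : 1 ≤ p) (j : ℕ) (X : Finset ℕ) (F : ℕ → A) :
    ∏ s ∈ X, ∏ t ∈ B p j s, F t = ∏ t ∈ X.biUnion (B p j), F t := by
  rw [Finset.prod_biUnion]
  intro s _ s' _ hne
  rw [Function.onFun, Finset.disjoint_left]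
  intro t ht ht'
  rw [mem_B hp] at ht ht'
  exact hne (ht.symm.trans ht')

theorem C_comp {A : Type*} [CommRing A] {m p : ℕ} (hm : 1 ≤ m) (hp : 1 ≤ p) (i j : ℕ)
    (a : ℕ → ℕ → A) {x y : ℕ} (hxy : x < y) :
    C m i (C p j a) x y =
      ∏ s ∈ (B m i x).biUnion (B p j), ∏ t ∈ (B m i y).biUnion (B p j), a s t := by
  rw [C_eq hm i _ hxy, ← prod_B hp]
  refine Finset.prod_congr rfl fun s hs => ?_
  have : ∏ t ∈ B m i y, C p j a s t = ∏ t ∈ B m i y, ∏ s' ∈ B p j s, ∏ t' ∈ B p j t, a s' t' := by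
    refine Finset.prod_congr rfl fun t ht => C_eq hp j a ?_
    rw [mem_B hm] at hs ht
    unfold D at hs ht
    split_ifs at hs ht <;> omega
  rw [this, Finset.prod_comm]
  exact Finset.prod_congr rfl fun s' _ => prod_B hp _ _ _

theorem biUnion_eq {m p m' p' : ℕ} (hm : 1 ≤ m) (hp : 1 ≤ p) (hm' : 1 ≤ m') (hp' : 1 ≤ p')
    {i j i' j' : ℕ} (H : ∀ t, D m i (D p j t) = D m' i' (D p' j' t)) (x : ℕ) :
    (B m i x).biUnion (B p j) = (B m' i' x).biUnion (B p' j') := by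
  ext t
  simp only [Finset.mem_biUnion, mem_B hm, mem_B hp, mem_B hm', mem_B hp', exists_eq_right',
    exists_eq_right, H]

theorem C_comm {A : Type*} [CommRing A] {m p : ℕ} (hm : 1 ≤ m) (hp : 1 ≤ p) {i j : ℕ} (hij : i < j)
    (a : ℕ → ℕ → A) {x y : ℕ} (hxy : x < y) :
    C m i (C p (j + m - 1) a) x y = C p j (C m i a) x y := by
  rw [C_comp hm hp _ _ _ hxy, C_comp hp hm _ _ _ hxy]
  have := biUnion_eq hm hp hp hm (i := i) (j := j + m - 1) (i' := j) (j' := i) (by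
    intro t; unfold D; split_ifs <;> omega)
  rw [this, this]

theorem C_nest {A : Type*} [CommRing A] {m p : ℕ} (hm : 1 ≤ m) (hp : 1 ≤ p) {i j : ℕ} (hij : i ≤ j)
    (hj : j < i + m) (a : ℕ → ℕ → A) {x y : ℕ} (hxy : x < y) :
    C m i (C p j a) x y = C (m + p - 1) i a x y := by
  rw [C_comp hm hp _ _ _ hxy, C_eq (by omega) _ _ hxy]
  have : ∀ x, (B m i x).biUnion (B p j) = B (m + p - 1) i x := by
    intro x
    ext t
    simp only [Finset.mem_biUnion, mem_B hm, mem_B hp, mem_B (show 1 ≤ m + p - 1 by omega),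
      exists_eq_right', exists_eq_right]
    unfold D; split_ifs <;> omega
  rw [this, this]

theorem prod_shift {A : Type*} [CommRing A] {p : ℕ} (hp : 1 ≤ p) (i k x : ℕ) (hi : 1 ≤ i)
    (hk : 1 ≤ k) (hx : 1 ≤ x)
    (F : ℕ → A) : ∏ t ∈ B p (i + k - 1) (x + i - 1), F t = ∏ t ∈ B p k x, F (t + i - 1) := by
  refine Finset.prod_nbij' (fun t => t + 1 - i) (fun t => t + i - 1) ?_ ?_ ?_ ?_ ?_ <;> intro t ht <;>
    simp only [mem_B hp] at ht ⊢
  · unfold D at *; split_ifs at * <;> omega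
  · unfold D at *; split_ifs at * <;> omega
  · unfold D at *; split_ifs at * <;> omega
  · unfold D at *; split_ifs at * <;> omega
  · congr 1; unfold D at *; split_ifs at * <;> omega

theorem S_C {A : Type*} [CommRing A] {p : ℕ} (hp : 1 ≤ p) (i k : ℕ) (hi : 1 ≤ i)
    (hk : 1 ≤ k) (a : ℕ → ℕ → A) {x y : ℕ} (hx : 1 ≤ x) (hxy : x < y) :
    S i (C p (i + k - 1) a) x y = C p k (S i a) x y := by
  rw [C_eq hp _ _ hxy]
  unfold S
  rw [C_eq hp _ _ (by omega), prod_shift hp i k x hi hk hx]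
  exact Finset.prod_congr rfl fun s _ => prod_shift hp i k y hi hk (by omega) _

theorem S_C_low {A : Type*} [CommRing A] {p : ℕ} (hp : 1 ≤ p) (i j : ℕ) (hj : 1 ≤ j)
    (hij : j < i) (a : ℕ → ℕ → A) {x y : ℕ} (hx : 1 ≤ x) (hxy : x < y) :
    S i (C p j a) x y = S (i + p - 1) a x y := by
  unfold S C
  rw [if_neg (by omega), if_neg (by omega), if_neg (by omega), if_neg (by omega)]
  congr 1 <;> omega

theorem S_C_high {A : Type*} [CommRing A] {p : ℕ} (i j : ℕ) 
    (a : ℕ → ℕ → A) {x y : ℕ} (hx : 1 ≤ x) (hxy : x < y) (hy : y + i ≤ j) :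
    S i (C p j a) x y = S i a x y := by
  unfold S C
  rw [if_pos (by omega)]

theorem S_S {A : Type*} (i k : ℕ) (hi : 1 ≤ i) (hk : 1 ≤ k) (a : ℕ → ℕ → A) :
    S (i + k - 1) a = S k (S i a) := by
  funext x y
  unfold S
  congr 1 <;> omega

def P {A : Type*} [CommRing A] (n m p : ℕ) (f g h : (ℕ → ℕ → A) → A) (a : ℕ → ℕ → A) : A :=
  ∑ i ∈ Finset.Icc 1 n, ∑ j ∈ Finset.Icc 1 (i - 1),
    (-1 : A) ^ ((j - 1) * (p - 1) + (i - 1) * (m - 1)) *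
      (f (C m i (C p j a)) * g (S (i + p - 1) a) * h (S j a))

def Q {A : Type*} [CommRing A] (n m p : ℕ) (f g h : (ℕ → ℕ → A) → A) (a : ℕ → ℕ → A) : A :=
  ∑ i ∈ Finset.Icc 1 n, ∑ j ∈ Finset.Icc (i + 1) n,
    (-1 : A) ^ ((j + m - 1 - 1) * (p - 1) + (i - 1) * (m - 1)) *
      (f (C m i (C p (j + m - 1) a)) * g (S i a) * h (S (j + m - 1) a))

theorem Q_eq {A : Type*} [CommRing A] {n m p : ℕ} (hm : 1 ≤ m) (hp : 1 ≤ p)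
    (f g h : (ℕ → ℕ → A) → A) (hf : IsCochain n f) (a : ℕ → ℕ → A) :
    Q n m p f g h a = (-1 : A) ^ ((m - 1) * (p - 1)) * P n p m f h g a := by
  unfold P Q
  rw [Finset.sum_comm' (t' := Finset.Icc 1 n) (s' := fun j => Finset.Icc 1 (j - 1)) (by
    intro x y; simp only [Finset.mem_Icc]; omega)]
  simp only [Finset.mul_sum]
  refine Finset.sum_congr rfl fun j hj => Finset.sum_congr rfl fun i hi => ?_
  rw [Finset.mem_Icc] at hi hj
  rw [hf (C m i (C p (j + m - 1) a)) (C p j (C m i a))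
    (fun x y _ hxy _ => C_comm hm hp (by omega) a hxy)]
  obtain ⟨m, rfl⟩ : ∃ k, m = k + 1 := ⟨m - 1, by omega⟩
  obtain ⟨j, rfl⟩ : ∃ k, j = k + 1 := ⟨j - 1, by omega⟩
  have e : j + 1 + (m + 1) - 1 - 1 = j + m := by omega
  rw [e]
  simp only [Nat.add_sub_cancel]
  ring

theorem sum_split {A : Type*} [CommRing A] {n m i : ℕ} (hm : 1 ≤ m) (hi : 1 ≤ i) (hin : i ≤ n)
    (T : ℕ → A) :
    ∑ j ∈ Finset.Icc 1 (n + m - 1), T j = ∑ j ∈ Finset.Icc 1 (i - 1), T j +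
      ∑ k ∈ Finset.Icc 1 m, T (i + k - 1) + ∑ j ∈ Finset.Icc (i + 1) n, T (j + m - 1) := by
  have h1 : ∑ k ∈ Finset.Icc 1 m, T (i + k - 1) = ∑ j ∈ Finset.Icc i (i + m - 1), T j := by
    refine Finset.sum_nbij' (fun k => i + k - 1) (fun j => j + 1 - i) ?_ ?_ ?_ ?_ ?_ <;>
      simp only [Finset.mem_Icc] <;> intros <;> first | omega | trivial
  have h2 : ∑ j ∈ Finset.Icc (i + 1) n, T (j + m - 1) =
      ∑ j ∈ Finset.Icc (i + m) (n + m - 1), T j := by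
    refine Finset.sum_nbij' (fun k => k + m - 1) (fun j => j + 1 - m) ?_ ?_ ?_ ?_ ?_ <;>
      simp only [Finset.mem_Icc] <;> intros <;> first | omega | trivial
  rw [h1, h2, ← Finset.sum_union, ← Finset.sum_union]
  · congr 1
    ext t
    simp only [Finset.mem_union, Finset.mem_Icc]
    omega
  · rw [Finset.disjoint_left]
    intro t
    simp only [Finset.mem_union, Finset.mem_Icc]
    omega
  · rw [Finset.disjoint_left]
    intro t
    simp only [Finset.mem_Icc]
    omega

theorem main {A : Type*} [CommRing A] {n m p : ℕ} (hm : 1 ≤ m) (hp : 1 ≤ p)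
    (f g h : (ℕ → ℕ → A) → A) (hf : IsCochain n f) (hg : IsCochain m g)
    (a : ℕ → ℕ → A) :
    circS2 (n + m - 1) p (circS2 n m f g) h a =
      P n m p f g h a + circS2 n (m + p - 1) f (circS2 m p g h) a + Q n m p f g h a := by
  have e1 : circS2 (n + m - 1) p (circS2 n m f g) h a = ∑ i ∈ Finset.Icc 1 n,
      ∑ j ∈ Finset.Icc 1 (n + m - 1), (-1 : A) ^ ((j - 1) * (p - 1) + (i - 1) * (m - 1)) *
        (f (C m i (C p j a)) * g (S i (C p j a)) * h (S j a)) := by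
    rw [Finset.sum_comm]
    unfold circS2
    refine Finset.sum_congr rfl fun j _ => ?_
    rw [circAt_eq, Finset.sum_mul, Finset.mul_sum]
    refine Finset.sum_congr rfl fun i _ => ?_
    rw [circAt_eq]
    ring
  rw [e1]
  unfold P Q
  rw [circS2, ← Finset.sum_add_distrib, ← Finset.sum_add_distrib]
  refine Finset.sum_congr rfl fun i hi => ?_
  rw [Finset.mem_Icc] at hi
  rw [sum_split hm hi.1 hi.2]
  congr 1
  · congr 1
    · refine Finset.sum_congr rfl fun j hj => ?_
      rw [Finset.mem_Icc] at hj
      rw [hg (S i (C p j a)) (S (i + p - 1) a)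
        (fun x y hx hxy _ => S_C_low hp i j hj.1 (by omega) a hx hxy)]
    · rw [circAt_eq, circS2, Finset.mul_sum, Finset.mul_sum]
      refine Finset.sum_congr rfl fun k hk => ?_
      rw [Finset.mem_Icc] at hk
      rw [circAt_eq, ← S_S i k hi.1 hk.1,
        hf (C m i (C p (i + k - 1) a)) (C (m + p - 1) i a)
          (fun x y _ hxy _ => C_nest hm hp (by omega) (by omega) a hxy),
        hg (S i (C p (i + k - 1) a)) (C p k (S i a))
          (fun x y hx hxy _ => S_C hp i k hi.1 hk.1 a hx hxy)]
      obtain ⟨m, rfl⟩ : ∃ k, m = k + 1 := ⟨m - 1, by omega⟩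
      obtain ⟨p, rfl⟩ : ∃ k, p = k + 1 := ⟨p - 1, by omega⟩
      obtain ⟨i, rfl⟩ : ∃ k, i = k + 1 := ⟨i - 1, by omega⟩
      obtain ⟨k, rfl⟩ : ∃ l, k = l + 1 := ⟨k - 1, by omega⟩
      have e : i + 1 + (k + 1) - 1 - 1 = i + k := by omega
      have e' : m + 1 + (p + 1) - 1 - 1 = m + p := by omega
      rw [e, e']
      simp only [Nat.add_sub_cancel]
      ring
  · refine Finset.sum_congr rfl fun j hj => ?_
    rw [Finset.mem_Icc] at hj
    rw [hg (S i (C p (j + m - 1) a)) (S i a)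
      (fun x y hx hxy hy => S_C_high i _ a hx hxy (by omega))]

end S2

/-- the composition `∘` on `S²`-cochains satisfies the graded right pre-Lie
identity: `(f ∘ g) ∘ h - f ∘ (g ∘ h) = (-1)^{(m-1)(p-1)} ((f ∘ h) ∘ g - f ∘ (h ∘ g))`. -/
theorem circS2_graded_pre_lie {A : Type*} [CommRing A]
    (n m p : ℕ) (hn : 1 ≤ n) (hm : 1 ≤ m) (hp : 1 ≤ p)
    (f g h : (ℕ → ℕ → A) → A)
    (hf : IsCochain n f) (hg : IsCochain m g) (hh : IsCochain p h) :
    ∀ a : ℕ → ℕ → A,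
      circS2 (n + m - 1) p (circS2 n m f g) h a - circS2 n (m + p - 1) f (circS2 m p g h) a =
        (-1 : A) ^ ((m - 1) * (p - 1)) *
          (circS2 (n + p - 1) m (circS2 n p f h) g a -
            circS2 n (p + m - 1) f (circS2 p m h g) a) := by
  intro a
  rw [S2.main hm hp f g h hf hg, S2.main hp hm f h g hf hh, S2.Q_eq hm hp f g h hf,
    S2.Q_eq hp hm f h g hf, mul_comm (p - 1) (m - 1)]
  have e : (-1 : A) ^ ((m - 1) * (p - 1)) * (-1 : A) ^ ((m - 1) * (p - 1)) = 1 := by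
    rw [← mul_pow]; simp
  linear_combination (-S2.P n m p f g h a) * e
end

section
/- The bracket on $S^2$-cochains satisfies the graded Jacobi identity: for all $f\in C^n$, $g\in C^m$, $h\in C^p$, $(-1)^{(n-1)(p-1)}[[f,g],h]+(-1)^{(m-1)(n-1)}[[g,h],f]+(-1)^{(p-1)(m-1)}[[h,f],g]=0$; hence $[\,\cdot,\cdot\,]$ makes $\bigoplus_{n\ge1}C^n$ a graded Lie algebra (with degree $|f|=n-1$). -/
def s2col {A : Type*} [CommRing A] (m i : ℕ) (a : ℕ → ℕ → A) : ℕ → ℕ → A := fun p q =>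
      if q < i then a p q
      else if p < i ∧ q = i then ∏ t ∈ Finset.Icc i (i + m - 1), a p t
      else if p < i ∧ i < q then a p (q + m - 1)
      else if p = i ∧ i < q then ∏ t ∈ Finset.Icc i (i + m - 1), a t (q + m - 1)
      else a (p + m - 1) (q + m - 1)

def s2sh {A : Type*} (i : ℕ) (a : ℕ → ℕ → A) : ℕ → ℕ → A := fun p q => a (p + i - 1) (q + i - 1)

def s2lo (m i x : ℕ) : ℕ := if x ≤ i then x else x + m - 1
def s2hi (m i x : ℕ) : ℕ := if x < i then x else x + m - 1

theorem circAt_eq {A : Type*} [CommRing A] (f g : (ℕ → ℕ → A) → A) (m i : ℕ) (a : ℕ → ℕ → A) :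
    circAt f g m i a = f (s2col m i a) * g (s2sh i a) := rfl

theorem s2col_eq {A : Type*} [CommRing A] (m i : ℕ) (a : ℕ → ℕ → A) (p q : ℕ) (h : p < q) :
    s2col m i a p q = ∏ s ∈ Finset.Icc (s2lo m i p) (s2hi m i p),
      ∏ t ∈ Finset.Icc (s2lo m i q) (s2hi m i q), a s t := by
  unfold s2col s2lo s2hi
  rcases lt_trichotomy q i with h1 | h1 | h1
  · have : p < i := by omega
    simp [h1, this, h1.le, this.le]
  · subst h1
    simp [h, h.le]
  · have e1 : ¬ q < i := by omega
    have e2 : ¬ q ≤ i := by omega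
    have e3 : ¬ q = i := by omega
    rcases lt_trichotomy p i with h2 | h2 | h2
    · simp [h1, h2, e1, e2, e3, h2.le]
    · subst h2
      simp [h1, e1, e2]
    · have e4 : ¬ p < i := by omega
      have e5 : ¬ p ≤ i := by omega
      have e6 : ¬ p = i := by omega
      simp [e1, e2, e3, e4, e5, e6]

theorem s2prod_comp {A : Type*} [CommRing A] (m i : ℕ) (hm : 1 ≤ m) (F : ℕ → A) (x d : ℕ) :
    ∏ s ∈ Finset.Icc x (x + d), ∏ u ∈ Finset.Icc (s2lo m i s) (s2hi m i s), F u =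
      ∏ u ∈ Finset.Icc (s2lo m i x) (s2hi m i (x + d)), F u := by
  induction d with
  | zero => simp
  | succ d ih =>
    rw [← add_assoc, Finset.prod_Icc_succ_top (by omega), ih]
    have h1 : s2lo m i (x + d + 1) = s2hi m i (x + d) + 1 := by
      unfold s2lo s2hi; split_ifs <;> omega
    have h2 : s2hi m i (x + d) ≤ s2hi m i (x + d + 1) := by
      unfold s2hi; split_ifs <;> omega
    have h3 : s2lo m i x ≤ s2hi m i (x + d) + 1 := by
      unfold s2lo s2hi; split_ifs <;> omega
    rw [h1]
    rw [← Finset.prod_union]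
    · apply Finset.prod_congr _ (fun _ _ => rfl)
      ext u
      simp only [Finset.mem_union, Finset.mem_Icc]
      omega
    · rw [Finset.disjoint_left]
      intro u
      simp only [Finset.mem_Icc]
      omega

theorem s2prod_comp' {A : Type*} [CommRing A] (m i : ℕ) (hm : 1 ≤ m) (F : ℕ → A) (x y : ℕ)
    (h : x ≤ y) :
    ∏ s ∈ Finset.Icc x y, ∏ u ∈ Finset.Icc (s2lo m i s) (s2hi m i s), F u =
      ∏ u ∈ Finset.Icc (s2lo m i x) (s2hi m i y), F u := by
  obtain ⟨d, rfl⟩ := Nat.exists_eq_add_of_le h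
  exact s2prod_comp m i hm F x d

theorem s2lo_le_hi (m i x : ℕ) (hm : 1 ≤ m) : s2lo m i x ≤ s2hi m i x := by
  unfold s2lo s2hi; split_ifs <;> omega

theorem s2hi_lt_lo (m i x y : ℕ) (hm : 1 ≤ m) (h : x < y) : s2hi m i x < s2lo m i y := by
  unfold s2lo s2hi; split_ifs <;> omega

theorem s2col_col {A : Type*} [CommRing A] (m i p j : ℕ) (hm : 1 ≤ m) (hp : 1 ≤ p)
    (a : ℕ → ℕ → A) (x y : ℕ) (h : x < y) :
    s2col m i (s2col p j a) x y =
      ∏ s ∈ Finset.Icc (s2lo p j (s2lo m i x)) (s2hi p j (s2hi m i x)),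
      ∏ t ∈ Finset.Icc (s2lo p j (s2lo m i y)) (s2hi p j (s2hi m i y)), a s t := by
  rw [s2col_eq _ _ _ _ _ h]
  have key := s2hi_lt_lo m i x y hm h
  rw [← s2prod_comp' p j hp _ _ _ (s2lo_le_hi m i x hm)]
  apply Finset.prod_congr rfl
  intro s hs
  have e : ∀ t ∈ Finset.Icc (s2lo m i y) (s2hi m i y), s2col p j a s t =
      ∏ t' ∈ Finset.Icc (s2lo p j t) (s2hi p j t),
        ∏ s' ∈ Finset.Icc (s2lo p j s) (s2hi p j s), a s' t' := by
    intro t ht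
    rw [Finset.mem_Icc] at hs ht
    rw [s2col_eq _ _ _ _ _ (by omega), Finset.prod_comm]
  rw [Finset.prod_congr rfl e, s2prod_comp' p j hp _ _ _ (s2lo_le_hi m i y hm), Finset.prod_comm]

/-- Parallel composition, with `i < k`. -/
theorem s2par {A : Type*} [CommRing A] (n m p i k : ℕ) (hm : 1 ≤ m) (hp : 1 ≤ p)
    (hi : 1 ≤ i) (hik : i < k)
    (f g h : (ℕ → ℕ → A) → A)
    (hf : IsCochain n f) (hg : IsCochain m g) (hh : IsCochain p h) (a : ℕ → ℕ → A) :
    circAt (circAt f g m i) h p (k + m - 1) a = circAt (circAt f h p k) g m i a := by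
  simp only [circAt_eq]
  have e1 : f (s2col m i (s2col p (k + m - 1) a)) = f (s2col p k (s2col m i a)) := by
    apply hf
    intro x y hx hxy hy
    rw [s2col_col _ _ _ _ hm hp _ _ _ hxy, s2col_col _ _ _ _ hp hm _ _ _ hxy]
    have l : ∀ x, s2lo p (k + m - 1) (s2lo m i x) = s2lo m i (s2lo p k x) := by
      intro x; unfold s2lo; split_ifs <;> omega
    have u : ∀ x, s2hi p (k + m - 1) (s2hi m i x) = s2hi m i (s2hi p k x) := by
      intro x; unfold s2hi; split_ifs <;> omega
    rw [l, l, u, u]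
  have e2 : g (s2sh i (s2col p (k + m - 1) a)) = g (s2sh i a) := by
    apply hg
    intro x y hx hxy hy
    have : y + i - 1 < k + m - 1 := by omega
    simp [s2sh, s2col, this]
  have e3 : h (s2sh (k + m - 1) a) = h (s2sh k (s2col m i a)) := by
    apply hh
    intro x y hx hxy hy
    have h1 : ¬ y + k - 1 < i := by omega
    have h2 : ¬ x + k - 1 < i := by omega
    have h3 : ¬ x + k - 1 = i := by omega
    have h4 : x + k - 1 + m - 1 = x + (k + m - 1) - 1 := by omega
    have h5 : y + k - 1 + m - 1 = y + (k + m - 1) - 1 := by omega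
    simp [s2sh, s2col, h1, h2, h3, h4, h5]
  rw [e1, e2, e3]; ring

/-- Nested composition. -/
theorem s2nest {A : Type*} [CommRing A] (n m p i k : ℕ) (hm : 1 ≤ m) (hp : 1 ≤ p)
    (hi : 1 ≤ i) (hk : 1 ≤ k) (hkm : k ≤ m)
    (f g h : (ℕ → ℕ → A) → A)
    (hf : IsCochain n f) (hg : IsCochain m g) (a : ℕ → ℕ → A) :
    circAt (circAt f g m i) h p (i + k - 1) a =
      circAt f (circAt g h p k) (m + p - 1) i a := by
  simp only [circAt_eq]
  have e1 : f (s2col m i (s2col p (i + k - 1) a)) = f (s2col (m + p - 1) i a) := by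
    apply hf
    intro x y hx hxy hy
    rw [s2col_col _ _ _ _ hm hp _ _ _ hxy, s2col_eq _ _ _ _ _ hxy]
    have l : ∀ x, s2lo p (i + k - 1) (s2lo m i x) = s2lo (m + p - 1) i x := by
      intro x; unfold s2lo; split_ifs <;> omega
    have u : ∀ x, s2hi p (i + k - 1) (s2hi m i x) = s2hi (m + p - 1) i x := by
      intro x; unfold s2hi; split_ifs <;> omega
    rw [l, l, u, u]
  have e2 : g (s2sh i (s2col p (i + k - 1) a)) = g (s2col p k (s2sh i a)) := by
    apply hg
    intro x y hx hxy hy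
    rw [s2col_eq _ _ _ _ _ hxy]
    unfold s2sh
    rw [s2col_eq _ _ _ _ _ (by omega)]
    have sh : ∀ (F : ℕ → A) (u v : ℕ), 1 ≤ u → ∏ s ∈ Finset.Icc u v, F (s + i - 1) =
        ∏ s ∈ Finset.Icc (u + i - 1) (v + i - 1), F s := by
      intro F u v hu
      apply Finset.prod_bij (fun s _ => s + i - 1)
      · intro s hs
        rw [Finset.mem_Icc] at *
        omega
      · intro s hs t ht
        rw [Finset.mem_Icc] at *
        omega
      · intro s hs
        rw [Finset.mem_Icc] at hs
        exact ⟨s + 1 - i, by rw [Finset.mem_Icc]; omega, by omega⟩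
      · intros; rfl
    have l1 : ∀ x, 1 ≤ x → 1 ≤ s2lo p k x := by
      intro x; unfold s2lo; split_ifs <;> omega
    have l : ∀ x, 1 ≤ x → s2lo p (i + k - 1) (x + i - 1) = s2lo p k x + i - 1 := by
      intro x; unfold s2lo; split_ifs <;> omega
    have u : ∀ x, 1 ≤ x → s2hi p (i + k - 1) (x + i - 1) = s2hi p k x + i - 1 := by
      intro x; unfold s2hi; split_ifs <;> omega
    have hy1 : 1 ≤ y := by omega
    rw [l _ hx, u _ hx, l _ hy1, u _ hy1]
    rw [← sh (fun s => ∏ t ∈ Finset.Icc (s2lo p k y + i - 1) (s2hi p k y + i - 1), a s t) _ _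
      (l1 _ hx)]
    apply Finset.prod_congr rfl
    intro s _
    rw [← sh (fun t => a (s + i - 1) t) _ _ (l1 _ hy1)]
  have e3 : s2sh (i + k - 1) a = s2sh k (s2sh i a) := by
    funext x y
    unfold s2sh
    congr 1 <;> omega
  rw [e1, e2, e3]; ring

def s2L {A : Type*} [CommRing A] (N M P : ℕ) (f g h : (ℕ → ℕ → A) → A) (a : ℕ → ℕ → A) : A :=
  ∑ i ∈ Finset.range (N + 1), ∑ j ∈ Finset.range i,
    (-1 : A) ^ (j * P + i * M) * circAt (circAt f g (M + 1) (i + 1)) h (P + 1) (j + 1) a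

theorem circS2_range {A : Type*} [CommRing A] (N M : ℕ) (f g : (ℕ → ℕ → A) → A)
    (a : ℕ → ℕ → A) :
    circS2 (N + 1) (M + 1) f g a =
      ∑ i ∈ Finset.range (N + 1), (-1 : A) ^ (i * M) * circAt f g (M + 1) (i + 1) a := by
  unfold circS2
  have e := Finset.sum_Ico_add' (fun i => (-1 : A) ^ ((i - 1) * (M + 1 - 1)) *
    circAt f g (M + 1) i a) 0 (N + 1) 1
  simp only [Nat.add_sub_cancel] at e
  rw [Finset.range_eq_Ico, e]
  apply Finset.sum_congr _ (fun _ _ => rfl)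
  ext u
  simp only [Finset.mem_Icc, Finset.mem_Ico]
  omega

theorem s2split {A : Type*} [CommRing A] (N M i : ℕ) (hi : i ∈ Finset.range (N + 1)) (F : ℕ → A) :
    ∑ j ∈ Finset.range (N + M + 1), F j = ∑ j ∈ Finset.range i, F j +
      ∑ k ∈ Finset.range (M + 1), F (i + k) + ∑ k ∈ Finset.Ico (i + 1) (N + 1), F (k + M) := by
  rw [Finset.mem_range] at hi
  rw [← Finset.sum_range_add F i (M + 1), Finset.sum_Ico_add']
  rw [Finset.range_eq_Ico, Finset.range_eq_Ico,
    show i + 1 + M = i + (M + 1) by ring, show N + 1 + M = N + M + 1 by ring]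
  rw [Finset.sum_Ico_consecutive _ (by omega) (by omega)]

theorem s2assoc {A : Type*} [CommRing A] (N M P : ℕ) 
    (f g h : (ℕ → ℕ → A) → A)
    (hf : IsCochain (N + 1) f) (hg : IsCochain (M + 1) g) (hh : IsCochain (P + 1) h)
    (a : ℕ → ℕ → A) :
    circS2 (N + M + 1) (P + 1) (circS2 (N + 1) (M + 1) f g) h a =
      circS2 (N + 1) (M + P + 1) f (circS2 (M + 1) (P + 1) g h) a + s2L N M P f g h a
        + (-1) ^ (M * P) * s2L N P M f h g a := by
  have e1 : circS2 (N + M + 1) (P + 1) (circS2 (N + 1) (M + 1) f g) h a =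
      ∑ i ∈ Finset.range (N + 1), ∑ j ∈ Finset.range (N + M + 1),
        (-1 : A) ^ (j * P + i * M) *
          circAt (circAt f g (M + 1) (i + 1)) h (P + 1) (j + 1) a := by
    rw [circS2_range, Finset.sum_comm]
    apply Finset.sum_congr rfl
    intro j _
    rw [circAt_eq, circS2_range, Finset.sum_mul, Finset.mul_sum]
    apply Finset.sum_congr rfl
    intro i _
    rw [circAt_eq _ h, pow_add]; ring
  have e2 : circS2 (N + 1) (M + P + 1) f (circS2 (M + 1) (P + 1) g h) a =
      ∑ i ∈ Finset.range (N + 1), ∑ k ∈ Finset.range (M + 1),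
        (-1 : A) ^ ((i + k) * P + i * M) *
          circAt (circAt f g (M + 1) (i + 1)) h (P + 1) (i + k + 1) a := by
    rw [circS2_range]
    apply Finset.sum_congr rfl
    intro i _
    rw [circAt_eq, circS2_range, Finset.mul_sum, Finset.mul_sum]
    apply Finset.sum_congr rfl
    intro k hk
    rw [Finset.mem_range] at hk
    have := s2nest (N + 1) (M + 1) (P + 1) (i + 1) (k + 1) (by omega) (by omega) (by omega)
      (by omega) (by omega) f g h hf hg a
    rw [show i + 1 + (k + 1) - 1 = i + k + 1 by omega,
      show M + 1 + (P + 1) - 1 = M + P + 1 by omega] at this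
    rw [this, circAt_eq f]; ring
  have e3 : (-1) ^ (M * P) * s2L N P M f h g a =
      ∑ i ∈ Finset.range (N + 1), ∑ k ∈ Finset.Ico (i + 1) (N + 1),
        (-1 : A) ^ ((k + M) * P + i * M) *
          circAt (circAt f g (M + 1) (i + 1)) h (P + 1) (k + M + 1) a := by
    unfold s2L
    rw [Finset.mul_sum]
    simp_rw [Finset.mul_sum]
    rw [Finset.sum_comm' (t' := Finset.range (N + 1)) (s' := fun i => Finset.Ico (i + 1) (N + 1))]
    · apply Finset.sum_congr rfl
      intro i _
      apply Finset.sum_congr rfl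
      intro k hk
      rw [Finset.mem_Ico] at hk
      have := s2par (N + 1) (M + 1) (P + 1) (i + 1) (k + 1) (by omega) (by omega) (by omega)
        (by omega) f g h hf hg hh a
      rw [show k + 1 + (M + 1) - 1 = k + M + 1 by omega] at this
      rw [this]; ring
    · intro x y
      simp only [Finset.mem_Ico, Finset.mem_range]
      omega
  rw [e1, e2, e3, s2L, ← Finset.sum_add_distrib, ← Finset.sum_add_distrib]
  apply Finset.sum_congr rfl
  intro i hi
  rw [s2split N M i hi]; ring

theorem circS2_sub_left {A : Type*} [CommRing A] (n m : ℕ) (u v g : (ℕ → ℕ → A) → A) (c : A)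
    (a : ℕ → ℕ → A) :
    circS2 n m (fun b => u b - c * v b) g a = circS2 n m u g a - c * circS2 n m v g a := by
  unfold circS2
  rw [Finset.mul_sum, ← Finset.sum_sub_distrib]
  apply Finset.sum_congr rfl
  intro i _
  simp only [circAt_eq]; ring

theorem circS2_sub_right {A : Type*} [CommRing A] (n m : ℕ) (u v g : (ℕ → ℕ → A) → A) (c : A)
    (a : ℕ → ℕ → A) :
    circS2 n m g (fun b => u b - c * v b) a = circS2 n m g u a - c * circS2 n m g v a := by
  unfold circS2
  rw [Finset.mul_sum, ← Finset.sum_sub_distrib]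
  apply Finset.sum_congr rfl
  intro i _
  simp only [circAt_eq]; ring

theorem s2brack {A : Type*} [CommRing A] (N M P : ℕ)
    (f g h : (ℕ → ℕ → A) → A)
    (hf : IsCochain (N + 1) f) (hg : IsCochain (M + 1) g) (hh : IsCochain (P + 1) h)
    (a : ℕ → ℕ → A) :
    brackS2 (N + 1 + (M + 1) - 1) (P + 1) (brackS2 (N + 1) (M + 1) f g) h a =
      (circS2 (N + 1) (M + P + 1) f (circS2 (M + 1) (P + 1) g h) a + s2L N M P f g h a
        + (-1) ^ (M * P) * s2L N P M f h g a)
      - (-1) ^ (N * M) * (circS2 (M + 1) (N + P + 1) g (circS2 (N + 1) (P + 1) f h) a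
        + s2L M N P g f h a + (-1) ^ (N * P) * s2L M P N g h f a)
      - (-1) ^ (N * P) * (-1) ^ (M * P) *
        (circS2 (P + 1) (N + M + 1) h (circS2 (N + 1) (M + 1) f g) a
        - (-1) ^ (N * M) * circS2 (P + 1) (M + N + 1) h (circS2 (M + 1) (N + 1) g f) a) := by
  rw [← s2assoc N M P f g h hf hg hh, ← s2assoc M N P g f h hg hf hh]
  rw [show N + 1 + (M + 1) - 1 = N + M + 1 by omega, brackS2]
  have : brackS2 (N + 1) (M + 1) f g = fun b => circS2 (N + 1) (M + 1) f g b -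
    (-1) ^ (N * M) * circS2 (M + 1) (N + 1) g f b := rfl
  rw [this, circS2_sub_left, circS2_sub_right, add_comm M N]
  simp only [Nat.add_sub_cancel, add_mul, pow_add]

/-- the bracket on `S²`-cochains satisfies the graded Jacobi identity
`(-1)^{(n-1)(p-1)}[[f,g],h] + (-1)^{(m-1)(n-1)}[[g,h],f] + (-1)^{(p-1)(m-1)}[[h,f],g] = 0`;
hence `[·,·]` makes `⨁_{n≥1} Cⁿ` a graded Lie algebra (with `|f| = n - 1`). -/
theorem brackS2_graded_jacobi {A : Type*} [CommRing A]
    (n m p : ℕ) (hn : 1 ≤ n) (hm : 1 ≤ m) (hp : 1 ≤ p)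
    (f g h : (ℕ → ℕ → A) → A)
    (hf : IsCochain n f) (hg : IsCochain m g) (hh : IsCochain p h) :
    ∀ a : ℕ → ℕ → A,
      (-1 : A) ^ ((n - 1) * (p - 1)) * brackS2 (n + m - 1) p (brackS2 n m f g) h a +
        (-1 : A) ^ ((m - 1) * (n - 1)) * brackS2 (m + p - 1) n (brackS2 m p g h) f a +
        (-1 : A) ^ ((p - 1) * (m - 1)) * brackS2 (p + n - 1) m (brackS2 p n h f) g a = 0 := by
  intro a
  obtain ⟨N, rfl⟩ := Nat.exists_eq_add_of_le' hn
  obtain ⟨M, rfl⟩ := Nat.exists_eq_add_of_le' hm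
  obtain ⟨P, rfl⟩ := Nat.exists_eq_add_of_le' hp
  rw [s2brack N M P f g h hf hg hh, s2brack M P N g h f hg hh hf, s2brack P N M h f g hh hf hg]
  simp only [Nat.add_sub_cancel]
  rw [mul_comm M N, mul_comm P N, mul_comm P M, add_comm M N, add_comm P N, add_comm P M]
  rcases neg_one_pow_eq_or A (N * M) with h1 | h1 <;>
  rcases neg_one_pow_eq_or A (N * P) with h2 | h2 <;>
  rcases neg_one_pow_eq_or A (M * P) with h3 | h3 <;>
  rw [h1, h2, h3] <;> ring
end

section
/- If $f\in C^n$ satisfies $\delta_n(f)=0$ and $g\in C^m$ satisfies $\delta_m(g)=0$, then $\delta_{n+m-1}(f\circ g)=f\smile g-(-1)^{nm}\,g\smile f$ up to sign; more precisely, there is $\epsilon\in\{1,-1\}$ depending only on $n$ and $m$ such that $\delta_{n+m-1}(f\circ g)=\epsilon\big(f\smile g-(-1)^{nm}g\smile f\big)$, exhibiting $f\circ g$ as an explicit homotopy for graded commutativity of the cup product. -/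
namespace S2aux
open Finset

def Mg {A : Type*} [CommRing A] (i m : ℕ) (a : ℕ → ℕ → A) : ℕ → ℕ → A := fun p q =>
      if q < i then a p q
      else if p < i ∧ q = i then ∏ t ∈ Finset.range m, a p (i + t)
      else if p < i ∧ i < q then a p (q + m - 1)
      else if p = i ∧ i < q then ∏ t ∈ Finset.range m, a (i + t) (q + m - 1)
      else a (p + m - 1) (q + m - 1)

def Sh {A : Type*} (k : ℕ) (a : ℕ → ℕ → A) : ℕ → ℕ → A := fun p q => a (p + k) (q + k)

variable {A : Type*} [CommRing A]

lemma prod_blk (h : ℕ → A) (i m : ℕ) (hm : 1 ≤ m) :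
    ∏ t ∈ Finset.Icc i (i + m - 1), h t = ∏ t ∈ Finset.range m, h (i + t) := by
  have : Finset.Icc i (i + m - 1) = Finset.Ico i (i + m) := by
    ext x; simp only [Finset.mem_Icc, Finset.mem_Ico]; omega
  rw [this, Finset.prod_Ico_eq_prod_range]; simp

lemma M_ll {i m p q : ℕ} (a : ℕ → ℕ → A) (h : q < i) : Mg i m a p q = a p q := by
  simp [Mg, h]
lemma M_e {i m p q : ℕ} (a : ℕ → ℕ → A) (h : p < i) (hq : q = i) :
    Mg i m a p q = ∏ t ∈ Finset.range m, a p (i + t) := by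
  subst hq; simp [Mg, h]
lemma M_lr {i m p q : ℕ} (a : ℕ → ℕ → A) (h : p < i) (h' : i < q) :
    Mg i m a p q = a p (q + m - 1) := by
  have h1 : ¬ q < i := by omega
  have h2 : ¬ q = i := by omega
  simp [Mg, h, h1, h', h2]
lemma M_re {i m p q : ℕ} (a : ℕ → ℕ → A) (hp : p = i) (h' : i < q) :
    Mg i m a p q = ∏ t ∈ Finset.range m, a (i + t) (q + m - 1) := by
  have h1 : ¬ q < i := by omega
  have h2 : ¬ q = i := by omega
  simp [Mg, hp, h1, h', h2]
lemma M_rr {i m p q : ℕ} (a : ℕ → ℕ → A) (h : i < p) (h' : i < q) :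
    Mg i m a p q = a (p + m - 1) (q + m - 1) := by
  have h1 : ¬ q < i := by omega
  have h2 : ¬ q = i := by omega
  have h3 : ¬ p < i := by omega
  have h4 : ¬ p = i := by omega
  simp [Mg, h1, h2, h3, h4]

lemma prod_collapse (F h : ℕ → A) (u v m : ℕ)
    (h1 : ∀ t, t < u → F t = h t) (h2 : F u = ∏ t ∈ Finset.range m, h (u + t))
    (h3 : ∀ t, t < v → F (u + 1 + t) = h (u + m + t)) :
    ∏ t ∈ Finset.range (u + 1 + v), F t = ∏ t ∈ Finset.range (u + m + v), h t := by
  rw [Finset.prod_range_add, Finset.prod_range_succ, Finset.prod_range_add, Finset.prod_range_add,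
    h2]
  congr 1
  · congr 1
    exact Finset.prod_congr rfl fun t ht => h1 t (Finset.mem_range.1 ht)
  · exact Finset.prod_congr rfl fun t ht => h3 t (Finset.mem_range.1 ht)

/-- sequential -/
lemma M_seq (i k j l : ℕ) (a : ℕ → ℕ → A) (hk : 1 ≤ k) (hl : 1 ≤ l) (hij : i ≤ j)
    (hj : j < i + k) (p q : ℕ) (hpq : p < q) :
    Mg i k (Mg j l a) p q = Mg i (k + l - 1) a p q := by
  obtain ⟨u, rfl⟩ := Nat.exists_eq_add_of_le hij
  obtain ⟨v, rfl⟩ : ∃ v, k = u + 1 + v := ⟨k - u - 1, by omega⟩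
  rcases lt_trichotomy q i with h | h | h
  · rw [M_ll _ h, M_ll _ h, M_ll _ (by omega)]
  · rw [M_e _ (by omega) h, M_e _ (by omega) h]
    rw [show u + 1 + v + l - 1 = u + l + v by omega]
    apply prod_collapse
    · intro t ht; rw [M_ll _ (by omega)]
    · rw [M_e _ (by omega) rfl]; simp only [add_assoc]
    · intro t ht; rw [M_lr _ (by omega) (by omega)]; congr 1; omega
  · rcases lt_trichotomy p i with h' | h' | h'
    · rw [M_lr _ h' h, M_lr _ h' h, M_lr _ (by omega) (by omega)]; congr 1; omega
    · rw [M_re _ h' h, M_re _ h' h]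
      rw [show u + 1 + v + l - 1 = u + l + v by omega]
      apply prod_collapse
      · intro t ht; rw [M_lr _ (by omega) (by omega)]; congr 1; omega
      · rw [M_re _ rfl (by omega)]
        refine Finset.prod_congr rfl fun t _ => ?_
        congr 1 <;> omega
      · intro t ht; rw [M_rr _ (by omega) (by omega)]; congr 1 <;> omega
    · rw [M_rr _ h' h, M_rr _ h' h, M_rr _ (by omega) (by omega)]; congr 1 <;> omega

/-- parallel -/
lemma M_par (i k j l : ℕ) (a : ℕ → ℕ → A) (hk : 1 ≤ k) (hl : 1 ≤ l) (hij : j < i)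
    (p q : ℕ) (hpq : p < q) :
    Mg i k (Mg j l a) p q = Mg j l (Mg (i + l - 1) k a) p q := by
  rcases lt_trichotomy q j with h | h | h
  · rw [M_ll _ (by omega), M_ll _ h, M_ll _ h, M_ll _ (by omega)]
  · rw [M_ll _ (by omega), M_e _ (by omega) h, M_e _ (by omega) h]
    refine Finset.prod_congr rfl fun t ht => ?_
    rw [Finset.mem_range] at ht
    rw [M_ll _ (by omega)]
  · rcases lt_trichotomy q i with h2 | h2 | h2
    · rw [M_ll _ (by omega)]
      rcases lt_trichotomy p j with h' | h' | h'
      · rw [M_lr _ h' h, M_lr _ h' h, M_ll _ (by omega)]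
      · rw [M_re _ h' h, M_re _ h' h]
        refine Finset.prod_congr rfl fun t ht => ?_
        rw [M_ll _ (by omega)]
      · rw [M_rr _ h' h, M_rr _ h' h, M_ll _ (by omega)]
    · rw [M_e _ (by omega) h2]
      rcases lt_trichotomy p j with h' | h' | h'
      · rw [M_lr _ h' h, M_e _ (by omega) (by omega)]
        refine Finset.prod_congr rfl fun t ht => ?_
        rw [M_lr _ h' (by omega)]; congr 1; omega
      · rw [M_re _ h' h]
        have : ∀ t ∈ Finset.range k, Mg j l a p (i + t) =
            ∏ s ∈ Finset.range l, a (j + s) (i + l - 1 + t) := by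
          intro t ht
          rw [M_re _ h' (by omega)]
          refine Finset.prod_congr rfl fun s _ => ?_
          congr 1; omega
        rw [Finset.prod_congr rfl this, Finset.prod_comm]
        refine Finset.prod_congr rfl fun s hs => ?_
        rw [Finset.mem_range] at hs
        rw [M_e _ (by omega) (by omega)]
      · rw [M_rr _ h' h, M_e _ (by omega) (by omega)]
        refine Finset.prod_congr rfl fun t ht => ?_
        rw [M_rr _ h' (by omega)]; congr 1; omega
    · rcases lt_trichotomy p j with h' | h' | h'
      · rw [M_lr _ (by omega) h2, M_lr _ h' (by omega), M_lr _ h' h, M_lr _ (by omega) (by omega)]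
        congr 1; omega
      · rw [M_lr _ (by omega) h2, M_re _ h' (by omega), M_re _ h' h]
        refine Finset.prod_congr rfl fun t ht => ?_
        rw [Finset.mem_range] at ht
        rw [M_lr _ (by omega) (by omega)]
        congr 1; omega
      · rw [M_rr _ h' h]
        rcases lt_trichotomy p i with h3 | h3 | h3
        · rw [M_lr _ h3 h2, M_rr _ h' (by omega), M_lr _ (by omega) (by omega)]
          congr 1; omega
        · rw [M_re _ h3 h2, M_re _ (by omega) (by omega)]
          refine Finset.prod_congr rfl fun t ht => ?_
          rw [M_rr _ (by omega) (by omega)]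
          congr 1 <;> omega
        · rw [M_rr _ h3 h2, M_rr _ (by omega) (by omega), M_rr _ (by omega) (by omega)]
          congr 1 <;> omega

lemma Sh_M_gt (k j l : ℕ) (a : ℕ → ℕ → A) (hl : 1 ≤ l) (h : k < j) (p q : ℕ) (hpq : p < q) :
    Sh k (Mg j l a) p q = Mg (j - k) l (Sh k a) p q := by
  unfold Sh
  rcases lt_trichotomy q (j - k) with h | h | h
  · rw [M_ll _ h, M_ll _ (by omega)]
  · rw [M_e _ (by omega) h, M_e _ (by omega) (by omega)]
    refine Finset.prod_congr rfl fun t ht => ?_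
    congr 1; omega
  · rcases lt_trichotomy p (j - k) with h' | h' | h'
    · rw [M_lr _ h' h, M_lr _ (by omega) (by omega)]; congr 1; omega
    · rw [M_re _ h' h, M_re _ (by omega) (by omega)]
      refine Finset.prod_congr rfl fun t ht => ?_
      congr 1 <;> omega
    · rw [M_rr _ h' h, M_rr _ (by omega) (by omega)]; congr 1 <;> omega

lemma Sh_M_le (k j l : ℕ) (a : ℕ → ℕ → A) (hl : 1 ≤ l) (h : j ≤ k) (p q : ℕ) (hp : 1 ≤ p)
    (hpq : p < q) :
    Sh k (Mg j l a) p q = Sh (k + l - 1) a p q := by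
  unfold Sh
  rw [M_rr _ (by omega) (by omega)]; congr 1 <;> omega

lemma comb (n m : ℕ) (hm : 1 ≤ m) (R P Q : ℕ → ℕ → A)
    (h1 : ∀ i j, 1 ≤ i → i ≤ n → j < i → R i j = P (i + 1) j)
    (h2 : ∀ i k, 1 ≤ i → i ≤ n → k < m → R i (i + k) = Q i (k + 1))
    (h3 : ∀ i k, 1 ≤ i → i + k ≤ n → R i (i + m + k) = P i (i + 1 + k))
    (h4 : ∀ i, 1 ≤ i → i ≤ n → P (i + 1) i = Q i 0)
    (h5 : ∀ i, 1 ≤ i → i ≤ n → P i i = Q i (m + 1))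
    (hP : ∀ i, 1 ≤ i → i ≤ n + 1 → ∑ j ∈ range (n + 2), (-1 : A) ^ j * P i j = 0)
    (hQ : ∀ i, 1 ≤ i → i ≤ n → ∑ j ∈ range (m + 2), (-1 : A) ^ j * Q i j = 0) :
    ∑ i ∈ Icc 1 n, (-1 : A) ^ ((i - 1) * (m - 1)) *
      ∑ j ∈ range (n + m + 1), (-1 : A) ^ j * R i j =
    (-1 : A) ^ (m - 1 + n * m) * (P (n + 1) (n + 1) - (-1 : A) ^ (n * m) * P 1 0) := by
  obtain ⟨k, rfl⟩ : ∃ k, m = k + 1 := ⟨m - 1, by omega⟩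
  have sq : ∀ x : ℕ, (-1 : A) ^ x * (-1 : A) ^ x = 1 := by
    intro x; rw [← mul_pow]; simp
  have key : ∀ i, 1 ≤ i → i ≤ n → ∑ j ∈ range (n + (k + 1) + 1), (-1 : A) ^ j * R i j =
      ∑ j ∈ range (i + 1), (-1 : A) ^ j * P (i + 1) j -
        (-1) ^ k * ∑ j ∈ range i, (-1 : A) ^ j * P i j := by
    intro i hi hin
    obtain ⟨r, rfl⟩ := Nat.exists_eq_add_of_le hin
    have e1 := hP i hi (by omega)
    have e2 := hQ i hi hin
    rw [show i + r + 2 = i + 1 + (r + 1) by omega, Finset.sum_range_add,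
      Finset.sum_range_succ _ i, h5 i hi hin] at e1
    rw [Finset.sum_range_succ, Finset.sum_range_succ'] at e2
    rw [show i + r + (k + 1) + 1 = i + (k + 1) + (r + 1) by omega, Finset.sum_range_add,
      Finset.sum_range_add, Finset.sum_range_succ _ i, h4 i hi hin]
    rw [Finset.sum_congr rfl (fun j hj => by rw [h1 i j hi hin (Finset.mem_range.1 hj)] :
      ∀ j ∈ range i, (-1 : A) ^ j * R i j = (-1 : A) ^ j * P (i + 1) j)]
    have s2 : ∑ x ∈ range (k + 1), (-1 : A) ^ (i + x) * R i (i + x) =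
        - (-1) ^ i * ∑ x ∈ range (k + 1), (-1 : A) ^ (x + 1) * Q i (x + 1) := by
      rw [Finset.mul_sum]
      refine Finset.sum_congr rfl fun x hx => ?_
      rw [h2 i x hi hin (Finset.mem_range.1 hx)]; ring
    have s3 : ∑ x ∈ range (r + 1), (-1 : A) ^ (i + (k + 1) + x) * R i (i + (k + 1) + x) =
        (-1) ^ k * ∑ x ∈ range (r + 1), (-1 : A) ^ (i + 1 + x) * P i (i + 1 + x) := by
      rw [Finset.mul_sum]
      refine Finset.sum_congr rfl fun x hx => ?_
      rw [Finset.mem_range] at hx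
      rw [h3 i x hi (by omega)]; ring
    rw [s2, s3]
    linear_combination (-1) ^ k * e1 - (-1) ^ i * e2
  have tel : ∀ N, N ≤ n → ∑ i ∈ Icc 1 N, (-1 : A) ^ ((i - 1) * (k + 1 - 1)) *
      ∑ j ∈ range (n + (k + 1) + 1), (-1 : A) ^ j * R i j =
      (-1) ^ k * ((-1) ^ (N * k) * ∑ j ∈ range (N + 1), (-1 : A) ^ j * P (N + 1) j - P 1 0) := by
    intro N
    induction N with
    | zero => simp
    | succ N ih =>
      intro hN
      rw [Finset.sum_Icc_succ_top (by omega), ih (by omega), key (N + 1) (by omega) hN]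
      simp only [Nat.add_sub_cancel]
      have := sq k
      rw [show (N + 1) * k = N * k + k by ring, pow_add]
      linear_combination (- (-1) ^ (N * k) *
        ∑ j ∈ range (N + 1 + 1), (-1 : A) ^ j * P (N + 1 + 1) j) * this
  rw [tel n le_rfl]
  have e := hP (n + 1) (by omega) le_rfl
  rw [Finset.sum_range_succ] at e
  have s1 := sq n
  have s2 := sq (n * (k + 1))
  have s3 : (-1 : A) ^ (n * (k + 1)) = (-1) ^ (n * k) * (-1) ^ n := by
    rw [mul_add, pow_add, mul_one]
  have s4 := sq (n * k)
  simp only [Nat.add_sub_cancel, pow_add _ k]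
  rw [pow_succ] at e
  rw [s3] at s2 ⊢
  linear_combination (-1) ^ k * (-1) ^ (n * k) * e + (-1) ^ k * P 1 0 * s2

def Dd (n : ℕ) (f : (ℕ → ℕ → A) → A) (j : ℕ) (a : ℕ → ℕ → A) : A :=
  if j = 0 then (∏ t ∈ range n, a 1 (t + 2)) * f (Sh 1 a)
  else if j = n + 1 then (∏ t ∈ range n, a (t + 1) (n + 1)) * f a
  else a j (j + 1) * f (Mg j 2 a)

lemma Dd_zero (n : ℕ) (f : (ℕ → ℕ → A) → A) (a : ℕ → ℕ → A) :
    Dd n f 0 a = (∏ t ∈ range n, a 1 (t + 2)) * f (Sh 1 a) := by simp [Dd]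
lemma Dd_last {n j : ℕ} (f : (ℕ → ℕ → A) → A) (a : ℕ → ℕ → A) (h : j = n + 1) :
    Dd n f j a = (∏ t ∈ range n, a (t + 1) (n + 1)) * f a := by simp [Dd, h]
lemma Dd_mid {n j : ℕ} (f : (ℕ → ℕ → A) → A) (a : ℕ → ℕ → A) (h : 1 ≤ j) (h' : j ≤ n) :
    Dd n f j a = a j (j + 1) * f (Mg j 2 a) := by
  have h1 : ¬ j = 0 := by omega
  have h2 : ¬ j = n + 1 := by omega
  simp [Dd, h1, h2]

lemma delta_eq (n : ℕ) (f : (ℕ → ℕ → A) → A) (a : ℕ → ℕ → A) :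
    deltaS2 n f a = ∑ j ∈ range (n + 2), (-1 : A) ^ j * Dd n f j a := by
  rw [Finset.sum_range_succ, Finset.sum_range_succ', Dd_zero, Dd_last f a rfl]
  unfold deltaS2
  have e1 : Finset.Icc 2 (n + 1) = Finset.Ico 2 (n + 2) := by
    ext x; simp only [Finset.mem_Icc, Finset.mem_Ico]; omega
  have e2 : Finset.Icc 1 n = Finset.Ico 1 (n + 1) := by
    ext x; simp only [Finset.mem_Icc, Finset.mem_Ico]; omega
  rw [e1, e2, Finset.prod_Ico_eq_prod_range, Finset.prod_Ico_eq_prod_range,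
    Finset.sum_Ico_eq_sum_range]
  simp only [Nat.add_sub_cancel, pow_zero, one_mul]
  rw [add_comm (_ * _) (∑ x ∈ _, _), mul_assoc]
  congr 1
  congr 1
  · refine Finset.sum_congr rfl fun j hj => ?_
    rw [Finset.mem_range] at hj
    rw [Dd_mid f a (by omega) (by omega), add_comm 1 j]
    congr 3
    funext p q
    simp [Mg, Finset.prod_range_succ]
  · congr 1
    exact Finset.prod_congr rfl fun t _ => by rw [add_comm]
  · congr 2
    exact Finset.prod_congr rfl fun t _ => by rw [add_comm]

lemma circAt_eq (f g : (ℕ → ℕ → A) → A) (m i : ℕ) (hm : 1 ≤ m) (hi : 1 ≤ i) (a : ℕ → ℕ → A) :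
    circAt f g m i a = f (Mg i m a) * g (Sh (i - 1) a) := by
  unfold circAt
  congr 2
  · funext p q
    simp only [Mg, prod_blk _ i m hm]
  · funext p q
    simp only [Sh]
    congr 1 <;> omega

lemma Dd_circ (N n m : ℕ) (f g : (ℕ → ℕ → A) → A) (j : ℕ) (a : ℕ → ℕ → A) :
    Dd N (circS2 n m f g) j a =
      ∑ i ∈ Icc 1 n, (-1 : A) ^ ((i - 1) * (m - 1)) * Dd N (circAt f g m i) j a := by
  unfold Dd circS2
  split_ifs <;> rw [Finset.mul_sum] <;> refine Finset.sum_congr rfl fun i _ => ?_ <;> ring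

theorem main {n m : ℕ} (hn : 1 ≤ n) (hm : 1 ≤ m) (f g : (ℕ → ℕ → A) → A)
    (hf : IsCochain n f) (hg : IsCochain m g)
    (df : ∀ a : ℕ → ℕ → A, deltaS2 n f a = 0) (dg : ∀ a : ℕ → ℕ → A, deltaS2 m g a = 0)
    (a : ℕ → ℕ → A) :
    deltaS2 (n + m - 1) (circS2 n m f g) a =
      (-1 : A) ^ (m - 1 + n * m) * (cupS2 n m f g a - (-1 : A) ^ (n * m) * cupS2 m n g f a) := by
  have hc := comb n m hm (fun i j => Dd (n + m - 1) (circAt f g m i) j a)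
    (fun i j => Dd n f j (Mg i m a) * g (Sh (i - 1) a))
    (fun i j => f (Mg i (m + 1) a) * Dd m g j (Sh (i - 1) a))
    ?_ ?_ ?_ ?_ ?_ ?_ ?_
  · rw [delta_eq]
    simp only [Dd_circ, Finset.mul_sum]
    rw [Finset.sum_comm]
    simp only [Finset.mul_sum] at hc
    rw [show n + m - 1 + 2 = n + m + 1 by omega]
    have c1 : cupS2 n m f g a = Dd n f (n + 1) (Mg (n + 1) m a) * g (Sh (n + 1 - 1) a) := by
      rw [Dd_last _ _ rfl]
      unfold cupS2
      have e1 : f a = f (Mg (n + 1) m a) := hf _ _ fun p q h1 h2 h3 => by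
        rw [M_ll _ (by omega)]
      rw [← e1]
      congr 2
      rw [show Finset.Icc 1 n = Finset.Icc 1 (1 + n - 1) by congr 1; omega, prod_blk _ 1 n hn]
      refine Finset.prod_congr rfl fun t ht => ?_
      rw [Finset.mem_range] at ht
      rw [show n + m = n + 1 + m - 1 by omega, prod_blk _ _ _ hm, M_e _ (by omega) rfl, add_comm 1]
    have c2 : cupS2 m n g f a = Dd n f 0 (Mg 1 m a) * g (Sh (1 - 1) a) := by
      rw [Dd_zero]
      unfold cupS2
      have e1 : f (fun p q => a (p + m) (q + m)) = f (Sh 1 (Mg 1 m a)) :=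
        hf _ _ fun p q h1 h2 h3 => by
          rw [Sh_M_le _ _ _ _ hm le_rfl p q h1 h2]; simp only [Sh]; congr 1 <;> omega
      have e2 : Sh (1 - 1) a = a := rfl
      rw [e1, e2, mul_right_comm]
      congr 2
      rw [show Finset.Icc 1 m = Finset.Icc 1 (1 + m - 1) by congr 1; omega, prod_blk _ 1 m hm,
        Finset.prod_comm, show m + n = m + 1 + n - 1 by omega, prod_blk _ _ _ hn]
      refine Finset.prod_congr rfl fun t ht => ?_
      rw [M_re _ rfl (by omega)]
      refine Finset.prod_congr rfl fun s _ => ?_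
      congr 1; omega
    rw [c1, c2, ← hc]
    refine Finset.sum_congr rfl fun i _ => Finset.sum_congr rfl fun j _ => ?_
    ring
  · -- j < i
    intro i j hi hin hj
    rcases Nat.eq_zero_or_pos j with rfl | hj0
    · simp only [Dd_zero]
      rw [circAt_eq f g m i hm hi]
      have e1 : f (Mg i m (Sh 1 a)) = f (Sh 1 (Mg (i + 1) m a)) :=
        hf _ _ fun p q h1 h2 h3 => by
          rw [Sh_M_gt 1 (i + 1) m a hm (by omega) p q h2]; simp
      have e2 : Sh (i - 1) (Sh 1 a) = Sh (i + 1 - 1) a := by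
        funext p q; simp only [Sh]; congr 1 <;> omega
      rw [e1, e2, ← mul_assoc]
      congr 2
      obtain ⟨u, rfl⟩ : ∃ u, i = u + 1 := ⟨i - 1, by omega⟩
      obtain ⟨v, rfl⟩ := Nat.exists_eq_add_of_le hin
      rw [show u + 1 + v + m - 1 = u + m + v by omega]
      symm
      apply prod_collapse
      · intro t ht; rw [M_ll _ (by omega)]
      · rw [M_e _ (by omega) rfl]
        refine Finset.prod_congr rfl fun s _ => ?_
        congr 1; omega
      · intro t ht; rw [M_lr _ (by omega) (by omega)]; congr 1; omega
    · beta_reduce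
      rw [Dd_mid _ _ hj0 (by omega), Dd_mid _ _ hj0 (by omega), circAt_eq f g m i hm hi,
        M_ll _ (by omega)]
      have e1 : f (Mg i m (Mg j 2 a)) = f (Mg j 2 (Mg (i + 1) m a)) :=
        hf _ _ fun p q h1 h2 h3 => by
          rw [M_par i m j 2 a hm (by omega) hj p q h2]; rfl
      have e2 : g (Sh (i - 1) (Mg j 2 a)) = g (Sh (i + 1 - 1) a) :=
        hg _ _ fun p q h1 h2 h3 => by
          rw [Sh_M_le _ _ _ _ (by omega) (by omega) p q h1 h2]; congr 1; omega
      rw [e1, e2, mul_assoc]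
  · -- middle
    intro i k hi hin hk
    beta_reduce
    rw [Dd_mid _ _ (by omega) (by omega), Dd_mid _ _ (by omega) (by omega),
      circAt_eq f g m i hm hi]
    have e1 : f (Mg i m (Mg (i + k) 2 a)) = f (Mg i (m + 1) a) :=
      hf _ _ fun p q h1 h2 h3 => by
        rw [M_seq i m (i + k) 2 a hm (by omega) (by omega) (by omega) p q h2]; rfl
    have e2 : g (Sh (i - 1) (Mg (i + k) 2 a)) = g (Mg (k + 1) 2 (Sh (i - 1) a)) :=
      hg _ _ fun p q h1 h2 h3 => by
        rw [Sh_M_gt _ _ _ _ (by omega) (by omega) p q h2]; congr 1; omega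
    have e3 : Sh (i - 1) a (k + 1) (k + 1 + 1) = a (i + k) (i + k + 1) := by
      simp only [Sh]; congr 1 <;> omega
    rw [e1, e2, e3]; ring
  · -- right
    intro i k hi hik
    beta_reduce
    have e2 : g (Sh (i - 1) (Mg (i + m + k) 2 a)) = g (Sh (i - 1) a) :=
      hg _ _ fun p q h1 h2 h3 => by
        simp only [Sh]; rw [M_ll _ (by omega)]
    rcases Nat.lt_or_ge (i + k) n with h | h
    · rw [Dd_mid _ _ (by omega) (by omega), Dd_mid _ _ (by omega) (by omega),
        circAt_eq f g m i hm hi]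
      have e1 : f (Mg i m (Mg (i + m + k) 2 a)) = f (Mg (i + 1 + k) 2 (Mg i m a)) :=
        hf _ _ fun p q h1 h2 h3 => by
          rw [M_par (i + 1 + k) 2 i m a (by omega) hm (by omega) p q h2]
          congr 2; omega
      rw [e1, e2, M_rr _ (by omega) (by omega), ← mul_assoc]
      congr 3 <;> omega
    · rw [Dd_last _ _ (by omega), Dd_last _ _ (by omega), circAt_eq f g m i hm hi, ← mul_assoc]
      congr 2
      obtain ⟨u, rfl⟩ : ∃ u, i = u + 1 := ⟨i - 1, by omega⟩
      obtain rfl : n = u + 1 + k := by omega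
      rw [show u + 1 + k + m - 1 = u + m + k by omega]
      symm
      apply prod_collapse
      · intro t ht; rw [M_lr _ (by omega) (by omega)]; congr 1; omega
      · rw [M_re _ rfl (by omega)]
        refine Finset.prod_congr rfl fun s _ => ?_
        congr 1 <;> omega
      · intro t ht; rw [M_rr _ (by omega) (by omega)]; congr 1 <;> omega
  · intro i hi hin
    beta_reduce
    rw [Dd_mid _ _ hi hin, Dd_zero, M_e _ (by omega) rfl]
    have e1 : f (Mg i 2 (Mg (i + 1) m a)) = f (Mg i (m + 1) a) :=
      hf _ _ fun p q h1 h2 h3 => by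
        rw [M_seq i 2 (i + 1) m a (by omega) hm (by omega) (by omega) p q h2]; congr 1; omega
    have e2 : Sh 1 (Sh (i - 1) a) = Sh (i + 1 - 1) a := by
      funext p q; simp only [Sh]; congr 1 <;> omega
    have e3 : ∏ t ∈ range m, Sh (i - 1) a 1 (t + 2) = ∏ t ∈ range m, a i (i + 1 + t) := by
      refine Finset.prod_congr rfl fun s _ => ?_
      simp only [Sh]; congr 1 <;> omega
    rw [e1, e2, e3]; ring
  · intro i hi hin
    beta_reduce
    rw [Dd_mid _ _ hi hin, Dd_last _ _ rfl, M_re _ rfl (by omega)]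
    have e1 : f (Mg i 2 (Mg i m a)) = f (Mg i (m + 1) a) :=
      hf _ _ fun p q h1 h2 h3 => by
        rw [M_seq i 2 i m a (by omega) hm (by omega) (by omega) p q h2]; congr 1; omega
    have e3 : ∏ t ∈ range m, Sh (i - 1) a (t + 1) (m + 1) =
        ∏ t ∈ range m, a (i + t) (i + 1 + m - 1) := by
      refine Finset.prod_congr rfl fun s _ => ?_
      simp only [Sh]; congr 1 <;> omega
    rw [e1, e3]; ring
  · intro i _ _
    have := df (Mg i m a)
    rw [delta_eq] at this
    simp only [← mul_assoc]
    rw [← Finset.sum_mul, this, zero_mul]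
  · intro i _ _
    have := dg (Sh (i - 1) a)
    rw [delta_eq] at this
    simp only [mul_left_comm _ (f _)]
    rw [← Finset.mul_sum, this, mul_zero]

end S2aux

/-- for cocycles `f ∈ Cⁿ` and `g ∈ Cᵐ` one has, up to a sign `ε ∈ {1, -1}`
depending only on `n` and `m`, `δ_{n+m-1}(f ∘ g) = ε (f ⌣ g - (-1)^{nm} g ⌣ f)`; the
composition `f ∘ g` is an explicit homotopy for graded commutativity of the cup product. -/
theorem deltaS2_circS2_is_cup_commutator {A : Type*} [CommRing A]
    (n m : ℕ) (hn : 1 ≤ n) (hm : 1 ≤ m) :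
    ∃ ε : A, (ε = 1 ∨ ε = -1) ∧
      ∀ f g : (ℕ → ℕ → A) → A, IsCochain n f → IsCochain m g →
        (∀ a : ℕ → ℕ → A, deltaS2 n f a = 0) → (∀ a : ℕ → ℕ → A, deltaS2 m g a = 0) →
        ∀ a : ℕ → ℕ → A,
          deltaS2 (n + m - 1) (circS2 n m f g) a =
            ε * (cupS2 n m f g a - (-1 : A) ^ (n * m) * cupS2 m n g f a) := by
  exact ⟨(-1) ^ (m - 1 + n * m), neg_one_pow_eq_or A _,
    fun f g hf hg df dg a => S2aux.main hn hm f g hf hg df dg a⟩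
end
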